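/- arXiv:1803.02968 — 6 statements merged into one kernel-verified Lean document; each statement's English description precedes it below -/
import Mathlib

section
/- Fix layer dimensions d_0, d_1, …, d_h and suppose there do NOT exist indices p1, p2 with 1 ≤ p1 < p2 ≤ h − 1 such that d_h > d_{p2} and d_0 > d_{p1}. Then for every n ≥ 1 and all matrices X ∈ ℝ^{d0×n} and Y ∈ ℝ^{dh×n}, every local minimum W̄ = (W̄_h, …, W̄_1), W̄ᵢ ∈ ℝ^{dᵢ×d_{i−1}}, of the objective f(W) = (1/2)·‖W_h···W_1·X − Y‖² is a global minimum of f. -/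
open Matrix

/-- Frobenius norm of a real matrix. -/
noncomputable def frob {m n : ℕ} (A : Matrix (Fin m) (Fin n) ℝ) : ℝ :=
  Real.sqrt (∑ i, ∑ j, (A i j) ^ 2)

/-- The product of the first `p` layer matrices: `chainProd d W p = W_{p-1} ⋯ W_1 W_0`
(so the paper's `W_i` is `W (i-1)` here, and `chainProd d W h = W_h ⋯ W_1` of the paper). -/
noncomputable def chainProd (d : ℕ → ℕ)
    (W : (i : ℕ) → Matrix (Fin (d (i + 1))) (Fin (d i)) ℝ) :
    (p : ℕ) → Matrix (Fin (d p)) (Fin (d 0)) ℝ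
  | 0 => 1
  | (p + 1) => W p * chainProd d W p

open Filter Topology

section LinearAlgebra

variable {k l m n r : ℕ}

theorem exists_left_inv_or_mulVec_eq_zero (A : Matrix (Fin m) (Fin n) ℝ) :
    (∃ L : Matrix (Fin n) (Fin m) ℝ, L * A = 1) ∨ ∃ u, u ≠ 0 ∧ A *ᵥ u = 0 := by
  by_cases hA : LinearMap.ker (Matrix.toLin' A) = ⊥
  · obtain ⟨g, hg⟩ := LinearMap.exists_leftInverse_of_injective _ hA
    refine .inl ⟨LinearMap.toMatrix' g, ?_⟩
    have := congrArg LinearMap.toMatrix' hg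
    rwa [LinearMap.toMatrix'_comp, LinearMap.toMatrix'_toLin', LinearMap.toMatrix'_id] at this
  · obtain ⟨u, hu, hu0⟩ := Submodule.exists_mem_ne_zero_of_ne_bot hA
    exact .inr ⟨u, hu0, by simpa using hu⟩

theorem exists_right_inv_or_vecMul_eq_zero (A : Matrix (Fin m) (Fin n) ℝ) :
    (∃ R : Matrix (Fin n) (Fin m) ℝ, A * R = 1) ∨ ∃ w, w ≠ 0 ∧ w ᵥ* A = 0 := by
  rcases exists_left_inv_or_mulVec_eq_zero Aᵀ with ⟨L, hL⟩ | ⟨u, hu, h⟩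
  · refine .inl ⟨Lᵀ, ?_⟩
    rw [← transpose_inj, transpose_mul, transpose_transpose, hL, transpose_one]
  · exact .inr ⟨u, hu, by rwa [mulVec_transpose] at h⟩

theorem le_of_left_inv {A : Matrix (Fin m) (Fin n) ℝ}
    {L : Matrix (Fin n) (Fin m) ℝ} (h : L * A = 1) : n ≤ m := by
  have h₁ : (1 : Matrix (Fin n) (Fin n) ℝ).rank ≤ m := by
    rw [← h]
    exact (rank_mul_le_right L A).trans (by simpa using A.rank_le_height)
  simpa using h₁

theorem le_of_right_inv {A : Matrix (Fin m) (Fin n) ℝ}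
    {R : Matrix (Fin n) (Fin m) ℝ} (h : A * R = 1) : m ≤ n :=
  le_of_left_inv h

theorem right_inv_of_left_inv {A : Matrix (Fin m) (Fin n) ℝ}
    {L : Matrix (Fin n) (Fin m) ℝ} (h : L * A = 1) (hmn : m ≤ n) :
    A * L = 1 := by
  obtain rfl : m = n := le_antisymm hmn (le_of_left_inv h)
  exact mul_eq_one_comm.mp h

/-- A Moore-Penrose inverse. -/
theorem exists_pseudoinverse (A : Matrix (Fin m) (Fin n) ℝ) :
    ∃ C : Matrix (Fin n) (Fin m) ℝ,
      A * C * A = A ∧ C * A * C = C ∧ (A * C)ᵀ = A * C ∧ (C * A)ᵀ = C * A := by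
  have hH : (Aᵀ * A).IsHermitian := by simp [IsHermitian, conjTranspose_eq_transpose_of_trivial]
  obtain ⟨O, D, hO, hD⟩ : ∃ (O : Matrix (Fin n) (Fin n) ℝ) (D : Fin n → ℝ),
      Oᵀ * O = 1 ∧ Aᵀ * A = O * diagonal D * Oᵀ := by
    refine ⟨hH.eigenvectorUnitary, hH.eigenvalues, ?_, ?_⟩
    · have := Unitary.coe_star_mul_self hH.eigenvectorUnitary
      rwa [star_eq_conjTranspose, conjTranspose_eq_transpose_of_trivial] at this
    · have := hH.spectral_theorem
      rw [Unitary.conjStarAlgAut_apply, star_eq_conjTranspose,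
        conjTranspose_eq_transpose_of_trivial] at this
      exact this
  set H' := O * diagonal D⁻¹ * Oᵀ with hH'
  have h_symm : H'ᵀ = H' := by simp [H', Matrix.mul_assoc]
  have h_mul (E F : Fin n → ℝ) : (O * diagonal E * Oᵀ) * (O * diagonal F * Oᵀ)
      = O * diagonal (E * F) * Oᵀ := by
    calc _ = O * diagonal E * (Oᵀ * O) * diagonal F * Oᵀ := by simp only [Matrix.mul_assoc]
      _ = _ := by rw [hO, Matrix.mul_one, Matrix.mul_assoc O, diagonal_mul_diagonal]; rfl
  have h_id : D⁻¹ * D * D⁻¹ = D⁻¹ := by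
    ext i; by_cases hi : D i = 0 <;> simp [hi]
  have h_id' : D * D⁻¹ * D = D := by
    ext i; by_cases hi : D i = 0 <;> simp [hi]
  have h_CA : (H' * Aᵀ * A) = O * diagonal (D⁻¹ * D) * Oᵀ := by
    rw [Matrix.mul_assoc, hD, h_mul]
  have h_AtA : Aᵀ * A * (H' * (Aᵀ * A)) = Aᵀ * A := by
    rw [hD, h_mul, h_mul, ← mul_assoc, h_id']
  refine ⟨H' * Aᵀ, ?_, ?_, ?_, ?_⟩
  · have h0 : (A * (H' * (Aᵀ * A)) - A)ᵀ * (A * (H' * (Aᵀ * A)) - A) = 0 := by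
      have : Aᵀ * (A * (H' * (Aᵀ * A)) - A) = 0 := by
        rw [Matrix.mul_sub, ← Matrix.mul_assoc, h_AtA, sub_self]
      rw [transpose_sub, Matrix.sub_mul, this, transpose_mul, Matrix.mul_assoc, this]
      simp
    rw [← conjTranspose_eq_transpose_of_trivial, conjTranspose_mul_self_eq_zero, sub_eq_zero] at h0
    simpa only [Matrix.mul_assoc] using h0
  · rw [h_CA, hH', ← Matrix.mul_assoc, h_mul, h_id]
  · simp [h_symm, Matrix.mul_assoc]
  · rw [h_CA]; simp [Matrix.mul_assoc]

theorem sq_frob (A : Matrix (Fin m) (Fin n) ℝ) : frob A ^ 2 = trace (Aᵀ * A) := by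
  rw [frob, Real.sq_sqrt (by positivity), Finset.sum_comm]
  simp [trace, Matrix.mul_apply, sq]

theorem trace_transpose_mul_self_nonneg (A : Matrix (Fin m) (Fin n) ℝ) :
    0 ≤ trace (Aᵀ * A) := by
  rw [← sq_frob]; positivity

theorem trace_transpose_mul_self_eq_sum (A : Matrix (Fin m) (Fin n) ℝ)
    (U : Matrix (Fin n) (Fin k) ℝ) :
    trace ((A * U)ᵀ * (A * U)) = ∑ j, (A *ᵥ U.col j) ⬝ᵥ (A *ᵥ U.col j) := by
  refine Finset.sum_congr rfl fun j _ => ?_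
  rw [diag_apply, Matrix.mul_apply]
  rfl

theorem trace_mul_le_trace_mul {A : Matrix (Fin m) (Fin n) ℝ} {B : Matrix (Fin l) (Fin n) ℝ}
    {c e : ℝ} (h : ∀ x, c * (A *ᵥ x) ⬝ᵥ (A *ᵥ x) ≤ e * (B *ᵥ x) ⬝ᵥ (B *ᵥ x))
    (U : Matrix (Fin n) (Fin k) ℝ) :
    c * trace ((A * U)ᵀ * (A * U)) ≤ e * trace ((B * U)ᵀ * (B * U)) := by
  rw [trace_transpose_mul_self_eq_sum, trace_transpose_mul_self_eq_sum, Finset.mul_sum,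
    Finset.mul_sum]
  exact Finset.sum_le_sum fun j _ => h _

theorem trace_sub_mul_self_of_isProj {P Q : Matrix (Fin m) (Fin m) ℝ} (hP : Pᵀ = P)
    (hPP : P * P = P) (hQ : Qᵀ = Q) (hQQ : Q * Q = Q) :
    trace ((P * (1 - Q))ᵀ * (P * (1 - Q))) = trace P - trace (P * Q) := by
  have : (P * (1 - Q))ᵀ * (P * (1 - Q)) = (1 - Q) * P * (1 - Q) := by
    rw [transpose_mul, hP, transpose_sub, transpose_one, hQ]
    simp only [Matrix.mul_assoc]
    rw [← Matrix.mul_assoc P P, hPP]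
  rw [this, trace_mul_comm, ← Matrix.mul_assoc, trace_mul_comm]
  have : (1 - Q) * (1 - Q) = 1 - Q := by
    simp [Matrix.sub_mul, Matrix.mul_sub, hQQ]
  rw [this, Matrix.mul_sub, Matrix.mul_one, trace_sub]

/-- The trace of the projection onto the column space of an `m × r` matrix. -/
theorem trace_mul_pseudoinverse_le {A : Matrix (Fin m) (Fin r) ℝ} {C : Matrix (Fin r) (Fin m) ℝ}
    (h : C * A * C = C) (hs : (C * A)ᵀ = C * A) : trace (A * C) ≤ r := by
  have h1 : (1 - C * A)ᵀ * (1 - C * A) = 1 - C * A := by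
    rw [transpose_sub, hs, transpose_one, Matrix.mul_sub, Matrix.mul_one, Matrix.sub_mul,
      Matrix.one_mul, ← Matrix.mul_assoc, h]
    simp
  have := trace_transpose_mul_self_nonneg (1 - C * A)
  rw [h1, trace_sub, trace_one, Fintype.card_fin] at this
  rw [trace_mul_comm]; linarith

end LinearAlgebra

section TwoLayer

variable {l m n r : ℕ}

/-- The square loss of the linear map `M`. -/
noncomputable def loss (X : Matrix (Fin m) (Fin n) ℝ) (Y : Matrix (Fin l) (Fin n) ℝ)
    (M : Matrix (Fin l) (Fin m) ℝ) : ℝ :=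
  (1 / 2) * frob (M * X - Y) ^ 2

/-- The gradient of `loss X Y` at `M`. -/
noncomputable def lossGrad (X : Matrix (Fin m) (Fin n) ℝ) (Y : Matrix (Fin l) (Fin n) ℝ)
    (M : Matrix (Fin l) (Fin m) ℝ) : Matrix (Fin l) (Fin m) ℝ :=
  (M * X - Y) * Xᵀ

theorem trace_transpose_mul_comm (A B : Matrix (Fin m) (Fin n) ℝ) :
    trace (Aᵀ * B) = trace (Bᵀ * A) := by
  rw [← trace_transpose, transpose_mul, transpose_transpose]

theorem trace_transpose_mul_self_add (A B : Matrix (Fin m) (Fin n) ℝ) :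
    trace ((A + B)ᵀ * (A + B)) = trace (Aᵀ * A) + 2 * trace (Aᵀ * B) + trace (Bᵀ * B) := by
  rw [transpose_add, Matrix.add_mul, Matrix.mul_add, Matrix.mul_add, trace_add, trace_add,
    trace_add, trace_transpose_mul_comm B A]
  ring

theorem trace_transpose_mul_self_sub (A B : Matrix (Fin m) (Fin n) ℝ) :
    trace ((A - B)ᵀ * (A - B)) = trace (Aᵀ * A) - 2 * trace (Aᵀ * B) + trace (Bᵀ * B) := by
  rw [sub_eq_add_neg, trace_transpose_mul_self_add]
  simp only [transpose_neg, Matrix.neg_mul, Matrix.mul_neg, neg_neg, trace_neg]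
  ring

theorem loss_add (X : Matrix (Fin m) (Fin n) ℝ) (Y : Matrix (Fin l) (Fin n) ℝ)
    (M E : Matrix (Fin l) (Fin m) ℝ) :
    loss X Y (M + E) = loss X Y M + trace ((lossGrad X Y M)ᵀ * E)
      + (1 / 2) * trace ((E * X)ᵀ * (E * X)) := by
  have h1 : (M + E) * X - Y = (M * X - Y) + E * X := by rw [Matrix.add_mul]; abel
  have h2 : trace ((lossGrad X Y M)ᵀ * E) = trace ((M * X - Y)ᵀ * (E * X)) := by
    rw [lossGrad, transpose_mul, transpose_transpose, Matrix.mul_assoc, trace_mul_comm,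
      Matrix.mul_assoc]
  rw [loss, loss, sq_frob, sq_frob, h1, trace_transpose_mul_self_add, h2]
  ring

theorem loss_le_of_lossGrad_eq_zero {X : Matrix (Fin m) (Fin n) ℝ} {Y : Matrix (Fin l) (Fin n) ℝ}
    {M : Matrix (Fin l) (Fin m) ℝ} (h : lossGrad X Y M = 0) (M' : Matrix (Fin l) (Fin m) ℝ) :
    loss X Y M ≤ loss X Y M' := by
  have := loss_add X Y M (M' - M)
  rw [h, add_sub_cancel] at this
  have h0 := trace_transpose_mul_self_nonneg ((M' - M) * X)
  rw [transpose_zero, Matrix.zero_mul, trace_zero] at this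
  linarith

/-- The minimum of `‖(A * B)ᵀ *ᵥ v‖` over unit vectors `v` in the column space of `A` is
attained. -/
theorem exists_min_on_range {A : Matrix (Fin l) (Fin r) ℝ} {L : Matrix (Fin r) (Fin l) ℝ}
    (hL : L * A = 1) (hr : r ≠ 0) (B : Matrix (Fin r) (Fin n) ℝ) :
    ∃ β, (A *ᵥ β) ⬝ᵥ (A *ᵥ β) = 1 ∧ ∀ γ, ((A * B)ᵀ *ᵥ (A *ᵥ β)) ⬝ᵥ ((A * B)ᵀ *ᵥ (A *ᵥ β))
      * (A *ᵥ γ) ⬝ᵥ (A *ᵥ γ) ≤ ((A * B)ᵀ *ᵥ (A *ᵥ γ)) ⬝ᵥ ((A * B)ᵀ *ᵥ (A *ᵥ γ)) := by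
  have h_left (γ : Fin r → ℝ) : L *ᵥ A *ᵥ γ = γ := by rw [mulVec_mulVec, hL, one_mulVec]
  let S : Set (Fin l → ℝ) := {v | v ⬝ᵥ v = 1 ∧ A *ᵥ L *ᵥ v = v}
  have hS : IsCompact S := by
    refine isCompact_Icc (a := fun _ => (-1 : ℝ)) (b := fun _ => 1) |>.of_isClosed_subset ?_ ?_
    · exact (isClosed_eq (by fun_prop) (by fun_prop)).inter
        (isClosed_eq (by fun_prop) (by fun_prop))
    · rintro v ⟨hv, -⟩
      have (i : Fin l) : v i * v i ≤ 1 := by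
        rw [← hv]
        exact Finset.single_le_sum (f := fun i => v i * v i) (fun i _ => mul_self_nonneg _)
          (Finset.mem_univ i)
      exact ⟨fun i => by nlinarith [this i], fun i => by nlinarith [this i]⟩
  have h_scale (γ : Fin r → ℝ) (hγ : A *ᵥ γ ≠ 0) :
      ∃ c : ℝ, c ^ 2 * (A *ᵥ γ) ⬝ᵥ (A *ᵥ γ) = 1 ∧ c • (A *ᵥ γ) ∈ S := by
    have hpos : 0 < (A *ᵥ γ) ⬝ᵥ (A *ᵥ γ) := by
      have := dotProduct_star_self_pos_iff.mpr hγ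
      simpa using this
    refine ⟨(√((A *ᵥ γ) ⬝ᵥ (A *ᵥ γ)))⁻¹, ?_, ?_, ?_⟩
    · rw [inv_pow, Real.sq_sqrt hpos.le, inv_mul_cancel₀ hpos.ne']
    · rw [smul_dotProduct, dotProduct_smul, smul_eq_mul, smul_eq_mul, ← mul_assoc, ← sq, inv_pow,
        Real.sq_sqrt hpos.le, inv_mul_cancel₀ hpos.ne']
    · rw [mulVec_smul, mulVec_smul, h_left]
  have hne : S.Nonempty := by
    have : NeZero r := ⟨hr⟩
    obtain ⟨c, -, hc⟩ := h_scale (Pi.single 0 1) fun h0 => by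
      have := h_left (Pi.single 0 1)
      rw [h0, mulVec_zero] at this
      simpa using congrFun this 0
    exact ⟨_, hc⟩
  obtain ⟨v, ⟨hv1, hv2⟩, hmin⟩ := hS.exists_isMinOn hne
    (f := fun v => ((A * B)ᵀ *ᵥ v) ⬝ᵥ ((A * B)ᵀ *ᵥ v)) (by fun_prop)
  refine ⟨L *ᵥ v, by rwa [hv2], fun γ => ?_⟩
  rw [hv2]
  by_cases hγ : A *ᵥ γ = 0
  · simp [hγ]
  obtain ⟨c, hc1, hc2⟩ := h_scale γ hγ
  have h1 := hmin hc2
  simp only [Set.mem_ofPred_eq, mulVec_smul, smul_dotProduct, dotProduct_smul, smul_eq_mul] at h1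
  have h2 : 0 ≤ (A *ᵥ γ) ⬝ᵥ (A *ᵥ γ) := by simpa using dotProduct_star_self_nonneg (A *ᵥ γ)
  calc _ ≤ _ := mul_le_mul_of_nonneg_right h1 h2
    _ = (c ^ 2 * (A *ᵥ γ) ⬝ᵥ (A *ᵥ γ)) *
        ((A * B)ᵀ *ᵥ (A *ᵥ γ)) ⬝ᵥ ((A * B)ᵀ *ᵥ (A *ᵥ γ)) := by ring
    _ = _ := by rw [hc1, one_mul]

theorem sq_le_mul_of_forall_nonneg {g p q : ℝ}
    (h : ∀ s : ℝ, 0 ≤ s * g + (1 / 2) * (s ^ 2 * p + q)) : g ^ 2 ≤ p * q := by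
  have := discrim_le_zero (a := p / 2) (b := g) (c := q / 2) fun s => by linarith [h s]
  rw [discrim] at this
  linarith

theorem trace_transpose_mul_self_vecMulVec (u : Fin m → ℝ) (v : Fin n → ℝ) :
    trace ((vecMulVec u v)ᵀ * vecMulVec u v) = (u ⬝ᵥ u) * (v ⬝ᵥ v) := by
  rw [transpose_vecMulVec, vecMulVec_mul_vecMulVec, trace_vecMulVec]
  simp

/-- The second-order condition at a critical point bounds the gradient on the orthogonal complement
of the column space of `A` by the least singular value of `A * B * X`. -/
theorem sq_dotProduct_le_of_second_order {A : Matrix (Fin l) (Fin r) ℝ}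
    {B : Matrix (Fin r) (Fin m) ℝ} {X : Matrix (Fin m) (Fin n) ℝ} {G : Matrix (Fin l) (Fin m) ℝ}
    (h2 : ∀ (a : Matrix (Fin l) (Fin r) ℝ) (b : Matrix (Fin r) (Fin m) ℝ),
      0 ≤ trace (Gᵀ * (a * b))
        + (1 / 2) * trace (((a * B + A * b) * X)ᵀ * ((a * B + A * b) * X)))
    {β : Fin r → ℝ} (hβ : (A *ᵥ β) ⬝ᵥ (A *ᵥ β) = 1) {x : Fin l → ℝ} (hx : Aᵀ *ᵥ x = 0)
    (y : Fin m → ℝ) :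
    (x ⬝ᵥ (G *ᵥ y)) ^ 2 ≤ (((A * B * X)ᵀ *ᵥ (A *ᵥ β)) ⬝ᵥ ((A * B * X)ᵀ *ᵥ (A *ᵥ β)) * (x ⬝ᵥ x))
      * ((Xᵀ *ᵥ y) ⬝ᵥ (Xᵀ *ᵥ y)) := by
  refine sq_le_mul_of_forall_nonneg fun s => ?_
  have h := h2 (vecMulVec (s • x) (Aᵀ *ᵥ (A *ᵥ β))) (vecMulVec β y)
  have hcross : trace ((vecMulVec (s • x) (Aᵀ *ᵥ (A *ᵥ β)) * B * X)ᵀ * (A * vecMulVec β y * X))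
      = 0 := by
    rw [vecMulVec_mul, vecMulVec_mul, transpose_vecMulVec, mul_vecMulVec A, vecMulVec_mul _ y,
      vecMulVec_mul_vecMulVec, smul_dotProduct, dotProduct_mulVec, ← mulVec_transpose A x, hx]
    simp
  rw [Matrix.add_mul, trace_transpose_mul_self_add, hcross, vecMulVec_mul_vecMulVec,
    vecMulVec_mul, vecMulVec_mul, mul_vecMulVec A, vecMulVec_mul _ y,
    trace_transpose_mul_self_vecMulVec, trace_transpose_mul_self_vecMulVec, hβ] at h
  have e1 : (Aᵀ *ᵥ A *ᵥ β) ⬝ᵥ β = 1 := by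
    rw [mulVec_transpose, ← dotProduct_mulVec, hβ]
  have e2 : (Aᵀ *ᵥ A *ᵥ β) ᵥ* B ᵥ* X = (A * B * X)ᵀ *ᵥ (A *ᵥ β) := by
    rw [mulVec_transpose, mulVec_transpose, vecMul_vecMul, vecMul_vecMul, Matrix.mul_assoc]
  rw [e1, e2, one_smul, mul_vecMulVec, trace_vecMulVec, ← mulVec_transpose X y,
    mulVec_smul, smul_dotProduct, mulVec_transpose,
    ← dotProduct_mulVec, smul_dotProduct, dotProduct_smul] at h
  simp only [smul_eq_mul, one_mul] at h
  linarith

/-- A second-order critical point of the two-layer problem with a left-invertible outer factor is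
a global minimum. -/
theorem loss_mul_le_of_second_order {X : Matrix (Fin m) (Fin n) ℝ} {Y : Matrix (Fin l) (Fin n) ℝ}
    {A : Matrix (Fin l) (Fin r) ℝ} {B : Matrix (Fin r) (Fin m) ℝ} {L : Matrix (Fin r) (Fin l) ℝ}
    (hL : L * A = 1) (hA : Aᵀ * lossGrad X Y (A * B) = 0) (hB : lossGrad X Y (A * B) * Bᵀ = 0)
    (h2 : ∀ (a : Matrix (Fin l) (Fin r) ℝ) (b : Matrix (Fin r) (Fin m) ℝ),
      0 ≤ trace ((lossGrad X Y (A * B))ᵀ * (a * b))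
        + (1 / 2) * trace (((a * B + A * b) * X)ᵀ * ((a * B + A * b) * X)))
    (A' : Matrix (Fin l) (Fin r) ℝ) (B' : Matrix (Fin r) (Fin m) ℝ) :
    loss X Y (A * B) ≤ loss X Y (A' * B') := by
  rcases eq_or_ne r 0 with rfl | hr
  · exact (congrArg (loss X Y) (by ext; simp [Matrix.mul_apply])).le
  obtain ⟨β, hβ, hmin⟩ := exists_min_on_range hL hr (B * X)
  rw [← Matrix.mul_assoc] at hmin
  have hbound {x : Fin l → ℝ} (hx : Aᵀ *ᵥ x = 0) (y : Fin m → ℝ) :=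
    sq_dotProduct_le_of_second_order h2 hβ hx y
  set G := lossGrad X Y (A * B) with hG
  set T := A * B * X with hT
  set c := (Tᵀ *ᵥ (A *ᵥ β)) ⬝ᵥ (Tᵀ *ᵥ (A *ᵥ β)) with hc
  have hc0 : 0 ≤ c := dotProduct_star_self_nonneg (Tᵀ *ᵥ (A *ᵥ β))
  obtain ⟨C, hC1, hC2, hC3, hC4⟩ := exists_pseudoinverse A
  obtain ⟨C', hC1', hC2', hC3', hC4'⟩ := exists_pseudoinverse A'
  obtain ⟨D, hD1, -, -, hD4⟩ := exists_pseudoinverse X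
  -- `K * X` is the projection of the residual to the row space of `X`
  obtain ⟨K, hK⟩ : ∃ K : Matrix (Fin l) (Fin m) ℝ, K * X * Xᵀ = G := by
    refine ⟨(T - Y) * D, ?_⟩
    rw [hG, lossGrad, Matrix.mul_assoc (T - Y), Matrix.mul_assoc (T - Y), ← hD4, ← transpose_mul,
      ← Matrix.mul_assoc, hD1]
  have hAK : Aᵀ * (K * X) = 0 := by
    rw [← Matrix.self_mul_conjTranspose_eq_zero, conjTranspose_eq_transpose_of_trivial,
      transpose_mul, transpose_mul, ← Matrix.mul_assoc, ← Matrix.mul_assoc, Matrix.mul_assoc Aᵀ, hK,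
      hA]
    simp
  have hTK : T * (K * X)ᵀ = 0 := by
    have : T * (K * X)ᵀ = A * (G * Bᵀ)ᵀ := by
      rw [← hK]; simp [hT, Matrix.mul_assoc]
    rw [this, hB]; simp
  set P := A * C with hP
  set Q := A' * C' with hQ
  have hPP : P * P = P := by rw [hP, ← Matrix.mul_assoc, hC1]
  have hQQ : Q * Q = Q := by rw [hQ, ← Matrix.mul_assoc, hC1']
  have hPr : trace P = r := by
    have : C * A = 1 := by
      calc C * A = L * (A * C * A) := by simp only [← Matrix.mul_assoc]; rw [hL, Matrix.one_mul]
        _ = 1 := by rw [hC1, hL]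
    rw [hP, trace_mul_comm, this, trace_one, Fintype.card_fin]
  have hQr : trace Q ≤ r := trace_mul_pseudoinverse_le hC2' hC4'
  have hPK : P * (K * X) = 0 := by
    rw [← hC3, transpose_mul, Matrix.mul_assoc, hAK, Matrix.mul_zero]
  have hPT : P * T = T := by
    rw [hT, Matrix.mul_assoc A B X, ← Matrix.mul_assoc, hC1]
  have h_upper (x : Fin l → ℝ) : ((K * X)ᵀ *ᵥ x) ⬝ᵥ ((K * X)ᵀ *ᵥ x)
      ≤ c * ((1 - P) *ᵥ x) ⬝ᵥ ((1 - P) *ᵥ x) := by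
    have hx : (K * X)ᵀ *ᵥ x = (K * X)ᵀ *ᵥ ((1 - P) *ᵥ x) := by
      have : (K * X)ᵀ * P = 0 := by rw [← hC3, ← transpose_mul, hPK, transpose_zero]
      rw [mulVec_mulVec, Matrix.mul_sub, this, Matrix.mul_one, sub_zero]
    have hz : Aᵀ *ᵥ ((1 - P) *ᵥ x) = 0 := by
      have : Aᵀ * P = Aᵀ := by rw [← hC3, ← transpose_mul, hC1]
      rw [mulVec_mulVec, Matrix.mul_sub, this, Matrix.mul_one, sub_self, zero_mulVec]
    rw [hx]
    generalize (1 - P) *ᵥ x = z at hz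
    have hb := hbound hz (Kᵀ *ᵥ z)
    have e1 : Xᵀ *ᵥ Kᵀ *ᵥ z = (K * X)ᵀ *ᵥ z := by rw [mulVec_mulVec, transpose_mul]
    have e2 : z ⬝ᵥ (G *ᵥ Kᵀ *ᵥ z) = ((K * X)ᵀ *ᵥ z) ⬝ᵥ ((K * X)ᵀ *ᵥ z) := by
      rw [← hK, ← mulVec_mulVec, e1, dotProduct_mulVec, ← mulVec_transpose]
    rw [e1, e2] at hb
    have h0 : 0 ≤ ((K * X)ᵀ *ᵥ z) ⬝ᵥ ((K * X)ᵀ *ᵥ z) := dotProduct_star_self_nonneg ((K * X)ᵀ *ᵥ z)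
    have hz0 : 0 ≤ z ⬝ᵥ z := by simpa using dotProduct_star_self_nonneg z
    rcases h0.eq_or_lt with h0 | h0
    · rw [← h0]; positivity
    · rw [sq] at hb
      exact le_of_mul_le_mul_right hb h0
  have h_lower (x : Fin l → ℝ) : c * (P *ᵥ x) ⬝ᵥ (P *ᵥ x) ≤ (Tᵀ *ᵥ x) ⬝ᵥ (Tᵀ *ᵥ x) := by
    have hx : Tᵀ *ᵥ x = Tᵀ *ᵥ (P *ᵥ x) := by
      rw [mulVec_mulVec]
      nth_rw 1 [← hPT]
      rw [transpose_mul, hC3]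
    rw [hx, hP, ← mulVec_mulVec]
    exact hmin _
  generalize hH : K * X = H at *
  set N := A' * B' * X with hN
  have hQN : Qᵀ * N = N := by rw [hC3', hN, ← Matrix.mul_assoc, ← Matrix.mul_assoc, hC1']
  have h1 : trace ((Hᵀ * Q)ᵀ * (Hᵀ * Q)) ≤ c * (trace Q - trace (P * Q)) := by
    have := trace_mul_le_trace_mul (c := 1) (fun x => (one_mul _).trans_le (h_upper x)) Q
    have e : trace (((1 - P) * Q)ᵀ * ((1 - P) * Q)) = trace Q - trace (P * Q) := by
      rw [trace_mul_comm P, ← trace_sub_mul_self_of_isProj hC3' hQQ hC3 hPP, trace_mul_comm]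
      simp only [transpose_mul, transpose_sub, transpose_one, hC3, hC3']
    rwa [one_mul, e] at this
  have h2 : c * (trace P - trace (P * Q)) ≤ trace ((Tᵀ * (1 - Q))ᵀ * (Tᵀ * (1 - Q))) := by
    have := trace_mul_le_trace_mul (e := 1) (fun x => (h_lower x).trans_eq (one_mul _).symm) (1 - Q)
    rwa [one_mul, trace_sub_mul_self_of_isProj hC3 hPP hC3' hQQ] at this
  have h3 : trace ((Q * (T - H))ᵀ * (Q * (T - H)))
      = trace ((Tᵀ * Q)ᵀ * (Tᵀ * Q)) + trace ((Hᵀ * Q)ᵀ * (Hᵀ * Q)) := by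
    have e1 : Q * (T - H) = (Tᵀ * Q - Hᵀ * Q)ᵀ := by
      rw [← Matrix.sub_mul, transpose_mul, hC3', transpose_sub, transpose_transpose,
        transpose_transpose]
    have e2 : (Tᵀ * Q)ᵀ * (Hᵀ * Q) = 0 := by
      rw [transpose_mul, transpose_transpose, Matrix.mul_assoc, ← Matrix.mul_assoc T, hTK]
      simp
    rw [e1, transpose_transpose, trace_mul_comm, trace_transpose_mul_self_sub, e2]
    simp
  have h4 : trace ((Tᵀ * Q)ᵀ * (Tᵀ * Q)) + trace ((Tᵀ * (1 - Q))ᵀ * (Tᵀ * (1 - Q)))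
      = trace (Tᵀ * T) := by
    have e1 : (Tᵀ * Q)ᵀ * (Tᵀ * Q) = Q * (T * Tᵀ) * Q := by
      simp only [transpose_mul, transpose_transpose, hC3', Matrix.mul_assoc]
    have e2 : trace (T * (Tᵀ * Q)) = trace (Q * (T * Tᵀ)) := by
      rw [← Matrix.mul_assoc, trace_mul_comm]
    have e3 : trace (Q * (T * Tᵀ) * Q) = trace (Q * (T * Tᵀ)) := by
      rw [trace_mul_comm, ← Matrix.mul_assoc, hQQ]
    rw [Matrix.mul_sub, Matrix.mul_one, trace_transpose_mul_self_sub, e1, transpose_transpose,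
      e2, e3, trace_mul_comm Tᵀ]
    ring
  have h5 : c * trace Q ≤ c * trace P := mul_le_mul_of_nonneg_left (by rwa [hPr]) hc0
  have h6 : 0 ≤ trace (Nᵀ * N) - 2 * trace (Nᵀ * (T - H)) + trace (Tᵀ * T) := by
    have := trace_transpose_mul_self_nonneg (N - Q * (T - H))
    have e : Nᵀ * (Q * (T - H)) = Nᵀ * (T - H) := by
      have : Nᵀ * Q = Nᵀ := by
        rw [← congrArg transpose hQN, transpose_mul Qᵀ N, transpose_transpose Q, Matrix.mul_assoc,
          hQQ]
      rw [← Matrix.mul_assoc, this]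
    rw [trace_transpose_mul_self_sub, e] at this
    linarith
  have h7 := loss_add X Y (A * B) (A' * B' - A * B)
  have e1 : trace (Gᵀ * (A' * B' - A * B)) = trace (Nᵀ * H) := by
    have : Gᵀ * A = 0 := by
      rw [← transpose_transpose A, ← transpose_mul, hA, transpose_zero]
    rw [Matrix.mul_sub, ← Matrix.mul_assoc Gᵀ A, this, Matrix.zero_mul, sub_zero,
      trace_transpose_mul_comm, ← hK, hN, trace_transpose_mul_comm, transpose_mul,
      transpose_transpose, Matrix.mul_assoc, trace_mul_comm, trace_transpose_mul_comm _ H,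
      Matrix.mul_assoc]
  rw [add_sub_cancel, ← hG, e1, Matrix.sub_mul, ← hN, ← hT, trace_transpose_mul_self_sub] at h7
  rw [Matrix.mul_sub, trace_sub] at h6
  linarith

end TwoLayer

section Network

variable {d : ℕ → ℕ}

/-- The weights of a network with layer widths `d`. -/
abbrev Weights (d : ℕ → ℕ) := (i : ℕ) → Matrix (Fin (d (i + 1))) (Fin (d i)) ℝ

/-- The product `W (b - 1) * ⋯ * W a`; only meaningful for `a ≤ b`. -/
noncomputable def seg (W : Weights d) (a : ℕ) : (b : ℕ) → Matrix (Fin (d b)) (Fin (d a)) ℝ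
  | 0 => of fun i j => if (i : ℕ) = j then 1 else 0
  | b + 1 => if a ≤ b then W b * seg W a b else of fun i j => if (i : ℕ) = j then 1 else 0

theorem seg_self (W : Weights d) (a : ℕ) : seg W a a = 1 := by
  cases a <;> ext i j <;> simp [seg, one_apply, Fin.ext_iff]

theorem seg_succ (W : Weights d) {a b : ℕ} (h : a ≤ b) : seg W a (b + 1) = W b * seg W a b := by
  simp [seg, h]

theorem seg_mul_seg (W : Weights d) {a b c : ℕ} (hab : a ≤ b) (hbc : b ≤ c) :
    seg W b c * seg W a b = seg W a c := by
  induction c, hbc using Nat.le_induction with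
  | base => rw [seg_self, Matrix.one_mul]
  | succ c hbc ih => rw [seg_succ W hbc, seg_succ W (hab.trans hbc), Matrix.mul_assoc, ih]

theorem seg_self_succ (W : Weights d) (a : ℕ) : seg W a (a + 1) = W a := by
  rw [seg_succ W le_rfl, seg_self, Matrix.mul_one]

theorem seg_succ_mul (W : Weights d) {a b : ℕ} (h : a < b) : seg W (a + 1) b * W a = seg W a b := by
  rw [← seg_self_succ W a, seg_mul_seg W a.le_succ h]

theorem seg_congr {W W' : Weights d} {a b : ℕ} (hab : a ≤ b)
    (h : ∀ i, a ≤ i → i < b → W i = W' i) : seg W a b = seg W' a b := by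
  induction b, hab using Nat.le_induction with
  | base => rw [seg_self, seg_self]
  | succ b hab ih =>
    rw [seg_succ W hab, seg_succ W' hab, h b hab b.lt_succ_self,
      ih fun i hai hib => h i hai (hib.trans b.lt_succ_self)]

theorem chainProd_eq_seg (W : Weights d) (p : ℕ) : chainProd d W p = seg W 0 p := by
  induction p with
  | zero => rw [seg_self]; rfl
  | succ p ih => rw [seg_succ W p.zero_le, ← ih]; rfl

/-- Adding `V` to layer `i` of `W`. -/
noncomputable def addLayer (W : Weights d) (i : ℕ) (V : Matrix (Fin (d (i + 1))) (Fin (d i)) ℝ) :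
    Weights d :=
  Function.update W i (W i + V)

theorem addLayer_self (W : Weights d) (i : ℕ) (V : Matrix (Fin (d (i + 1))) (Fin (d i)) ℝ) :
    addLayer W i V i = W i + V :=
  Function.update_self ..

theorem addLayer_of_ne (W : Weights d) {i j : ℕ} (hij : j ≠ i)
    (V : Matrix (Fin (d (i + 1))) (Fin (d i)) ℝ) : addLayer W i V j = W j :=
  Function.update_of_ne hij ..

theorem seg_addLayer_of_le (W : Weights d) {a b i : ℕ} (hab : a ≤ b) (hbi : b ≤ i)
    (V : Matrix (Fin (d (i + 1))) (Fin (d i)) ℝ) : seg (addLayer W i V) a b = seg W a b :=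
  seg_congr hab fun _ _ hj => addLayer_of_ne W (hj.trans_le hbi).ne V

theorem seg_addLayer_of_lt (W : Weights d) {a b i : ℕ} (hab : a ≤ b) (hia : i < a)
    (V : Matrix (Fin (d (i + 1))) (Fin (d i)) ℝ) : seg (addLayer W i V) a b = seg W a b :=
  seg_congr hab fun _ hj _ => addLayer_of_ne W (hia.trans_le hj).ne' V

theorem seg_addLayer (W : Weights d) {a b i : ℕ} (hai : a ≤ i) (hib : i < b)
    (V : Matrix (Fin (d (i + 1))) (Fin (d i)) ℝ) :
    seg (addLayer W i V) a b = seg W a b + seg W (i + 1) b * V * seg W a i := by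
  rw [← seg_mul_seg _ hai hib.le, ← seg_succ_mul _ hib, addLayer_self,
    seg_addLayer_of_lt W hib i.lt_succ_self, seg_addLayer_of_le W hai le_rfl, Matrix.mul_add,
    Matrix.add_mul, seg_succ_mul W hib, seg_mul_seg W hai hib.le]

theorem tendsto_addLayer_smul (W : Weights d) (i : ℕ)
    (V : Matrix (Fin (d (i + 1))) (Fin (d i)) ℝ) :
    Tendsto (fun t : ℝ => addLayer W i (t • V)) (𝓝 0) (𝓝 W) := by
  have hc : Continuous fun t : ℝ => addLayer W i (t • V) :=
    continuous_const.update i (by fun_prop)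
  simpa [addLayer] using hc.tendsto 0

theorem seg_addLayer_eq_of_mul_seg_eq_zero (W : Weights d) {a i : ℕ} (hai : a ≤ i)
    {V : Matrix (Fin (d (i + 1))) (Fin (d i)) ℝ} (hV : V * seg W a i = 0) {b : ℕ} (hab : a ≤ b) :
    seg (addLayer W i V) a b = seg W a b := by
  rcases le_or_gt b i with hbi | hib
  · exact seg_addLayer_of_le W hab hbi V
  · rw [seg_addLayer W hai hib, Matrix.mul_assoc, hV, Matrix.mul_zero, add_zero]

theorem seg_addLayer_eq_of_seg_mul_eq_zero (W : Weights d) {b i : ℕ} (hib : i < b)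
    {V : Matrix (Fin (d (i + 1))) (Fin (d i)) ℝ} (hV : seg W (i + 1) b * V = 0) {a : ℕ}
    (hab : a ≤ b) : seg (addLayer W i V) a b = seg W a b := by
  rcases lt_or_ge i a with hia | hai
  · exact seg_addLayer_of_lt W hab hia V
  · rw [seg_addLayer W hai hib, hV, Matrix.zero_mul, add_zero]

theorem eq_zero_of_forall_vecMulVec_right {l m n : ℕ} {M : Matrix (Fin l) (Fin m) ℝ}
    {w : Fin n → ℝ} (hw : w ≠ 0) (h : ∀ v : Fin m → ℝ, M * vecMulVec v w = 0) : M = 0 := by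
  obtain ⟨j, hj⟩ := Function.ne_iff.mp hw
  refine mulVec_injective (funext fun v => funext fun i => ?_)
  have hv := congrFun (congrFun (h v) i) j
  rw [mul_vecMulVec, vecMulVec_apply] at hv
  simpa using (mul_eq_zero.mp hv).resolve_right hj

/-- If the partial products `seg W 0 i`, `a ≤ i < b`, all have nontrivial left kernel, then an
equation `E * seg W a b = 0` that persists under all perturbations preserving the partial products
forces `E = 0`. -/
theorem eq_zero_of_left_kernels {W : Weights d} {a b k : ℕ} (hab : a ≤ b)
    (hker : ∀ i, a ≤ i → i < b → ∃ w, w ≠ 0 ∧ w ᵥ* seg W 0 i = 0)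
    {E : Matrix (Fin k) (Fin (d b)) ℝ}
    (hE : ∀ᶠ W' in 𝓝 W, (∀ p, seg W' 0 p = seg W 0 p) → (∀ i, b ≤ i → W' i = W i) →
      E * seg W' a b = 0) : E = 0 := by
  induction hn : b - a generalizing a with
  | zero =>
    obtain rfl : a = b := by omega
    simpa [seg_self] using hE.self_of_nhds (fun _ => rfl) fun _ _ => rfl
  | succ n ih =>
    have hlt : a < b := by omega
    refine ih (a := a + 1) hlt (fun i hi => hker i (by omega)) ?_ (by omega)
    obtain ⟨w, hw, hw0⟩ := hker a le_rfl hlt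
    filter_upwards [hE.eventually_nhds] with W' hW' hseg hout
    have h0 := hW'.self_of_nhds hseg hout
    refine eq_zero_of_forall_vecMulVec_right hw fun v => ?_
    have hev := ((tendsto_addLayer_smul W' a (vecMulVec v w)).eventually hW').filter_mono
      (nhdsWithin_le_nhds (s := {0}ᶜ))
    obtain ⟨t, ht, ht0⟩ := (hev.and self_mem_nhdsWithin).exists
    have hV : (t • vecMulVec v w) * seg W' 0 a = 0 := by
      rw [hseg, Matrix.smul_mul, vecMulVec_mul, hw0]
      ext
      simp [vecMulVec_apply]
    have h1 := ht
      (fun p => by rw [seg_addLayer_eq_of_mul_seg_eq_zero W' a.zero_le hV p.zero_le, hseg])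
      (fun i hi => by rw [addLayer_of_ne W' (by omega), hout i hi])
    rw [seg_addLayer W' le_rfl hlt, Matrix.mul_add, h0, zero_add, seg_self, Matrix.mul_one,
      Matrix.mul_smul, Matrix.mul_smul, ← Matrix.mul_assoc] at h1
    exact (smul_eq_zero.mp h1).resolve_left ht0

/-- The mirror image of `eq_zero_of_left_kernels`. -/
theorem eq_zero_of_right_kernels {W : Weights d} {a b h k : ℕ} (hab : a ≤ b) (hbh : b ≤ h)
    (hker : ∀ i, a < i → i ≤ b → ∃ u, u ≠ 0 ∧ seg W i h *ᵥ u = 0)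
    {E : Matrix (Fin (d a)) (Fin k) ℝ}
    (hE : ∀ᶠ W' in 𝓝 W, (∀ p ≤ h, seg W' p h = seg W p h) → (∀ i < a, W' i = W i) →
      seg W' a b * E = 0) : E = 0 := by
  induction hn : b - a generalizing b with
  | zero =>
    obtain rfl : a = b := by omega
    simpa [seg_self] using hE.self_of_nhds (fun _ _ => rfl) fun _ _ => rfl
  | succ n ih =>
    obtain ⟨b, rfl⟩ : ∃ c, b = c + 1 := ⟨b - 1, by omega⟩
    have hle : a ≤ b := by omega
    refine ih (b := b) hle (by omega) (fun i hi hib => hker i hi (by omega)) ?_ (by omega)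
    obtain ⟨u, hu, hu0⟩ := hker (b + 1) (by omega) le_rfl
    filter_upwards [hE.eventually_nhds] with W' hW' hseg hout
    have h0 := hW'.self_of_nhds hseg hout
    rw [← transpose_eq_zero]
    refine eq_zero_of_forall_vecMulVec_right hu fun v => ?_
    have hev := ((tendsto_addLayer_smul W' b (vecMulVec u v)).eventually hW').filter_mono
      (nhdsWithin_le_nhds (s := {0}ᶜ))
    obtain ⟨t, ht, ht0⟩ := (hev.and self_mem_nhdsWithin).exists
    have hV : seg W' (b + 1) h * (t • vecMulVec u v) = 0 := by
      rw [hseg _ hbh, Matrix.mul_smul, mul_vecMulVec, hu0, zero_vecMulVec, smul_zero]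
    have h1 := ht
      (fun p hp => by rw [seg_addLayer_eq_of_seg_mul_eq_zero W' hbh hV hp, hseg p hp])
      (fun i hi => by rw [addLayer_of_ne W' (by omega), hout i hi])
    rw [seg_addLayer W' hle b.lt_succ_self, Matrix.add_mul, h0, zero_add, seg_self, Matrix.one_mul,
      Matrix.smul_mul, Matrix.smul_mul, Matrix.mul_assoc] at h1
    rw [← transpose_vecMulVec, ← transpose_mul, (smul_eq_zero.mp h1).resolve_left ht0,
      transpose_zero]

variable {h n : ℕ} {X : Matrix (Fin (d 0)) (Fin n) ℝ} {Y : Matrix (Fin (d h)) (Fin n) ℝ}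

theorem eventually_isLocalMin_of_seg_eq {W : Weights d}
    (hW : IsLocalMin (fun W : Weights d => loss X Y (seg W 0 h)) W) :
    ∀ᶠ W' in 𝓝 W, seg W' 0 h = seg W 0 h →
      IsLocalMin (fun W : Weights d => loss X Y (seg W 0 h)) W' := by
  filter_upwards [Filter.Eventually.eventually_nhds hW] with W' hW' heq
  filter_upwards [hW'] with W'' h''
  rwa [heq]

theorem eq_zero_of_eventually_nonneg {g c : ℝ} (hgc : ∀ᶠ t in 𝓝 (0 : ℝ), 0 ≤ t * g + t ^ 2 * c) :
    g = 0 := by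
  have hd : HasDerivAt (fun t : ℝ => t * g + t ^ 2 * c) g 0 := by
    refine (((hasDerivAt_id (0 : ℝ)).mul_const g).add
      ((hasDerivAt_pow 2 (0 : ℝ)).mul_const c)).congr_deriv (by simp)
  refine IsLocalMin.hasDerivAt_eq_zero ?_ hd
  filter_upwards [hgc] with t ht
  simpa using ht

/-- The stationarity equation of a layer. -/
theorem seg_mul_lossGrad_mul_seg_eq_zero {W : Weights d}
    (hW : IsLocalMin (fun W : Weights d => loss X Y (seg W 0 h)) W) {i : ℕ} (hi : i < h) :
    seg W 0 i * (lossGrad X Y (seg W 0 h))ᵀ * seg W (i + 1) h = 0 := by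
  set N := seg W 0 i * (lossGrad X Y (seg W 0 h))ᵀ * seg W (i + 1) h with hN
  have hev := (tendsto_addLayer_smul W i Nᵀ).eventually hW
  have hg : trace ((lossGrad X Y (seg W 0 h))ᵀ * (seg W (i + 1) h * Nᵀ * seg W 0 i)) = 0 := by
    refine eq_zero_of_eventually_nonneg (c := (1 / 2) * trace
      ((seg W (i + 1) h * Nᵀ * seg W 0 i * X)ᵀ * (seg W (i + 1) h * Nᵀ * seg W 0 i * X))) ?_
    filter_upwards [hev] with t ht
    rw [seg_addLayer W i.zero_le hi, loss_add] at ht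
    simp only [Matrix.mul_smul, Matrix.smul_mul, transpose_smul, trace_smul, smul_eq_mul] at ht
    linarith
  have hNN : trace (N * Nᵀ) = 0 := by
    rw [← hg, ← Matrix.mul_assoc, trace_mul_comm _ (seg W 0 i), ← Matrix.mul_assoc,
      ← Matrix.mul_assoc, ← hN]
  rw [← conjTranspose_eq_transpose_of_trivial, trace_mul_conjTranspose_self_eq_zero_iff] at hNN
  exact hNN

theorem exists_vecMul_eq_zero_of_not_left_inv {k l : ℕ} {A : Matrix (Fin k) (Fin l) ℝ}
    (hlk : l ≤ k) (hA : ¬ ∃ L : Matrix (Fin l) (Fin k) ℝ, L * A = 1) :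
    ∃ w, w ≠ 0 ∧ w ᵥ* A = 0 :=
  (exists_right_inv_or_vecMul_eq_zero A).resolve_left fun ⟨R, hR⟩ =>
    hA ⟨R, right_inv_of_left_inv hR hlk⟩

theorem exists_mulVec_eq_zero_of_not_right_inv {k l : ℕ} {A : Matrix (Fin k) (Fin l) ℝ}
    (hkl : k ≤ l) (hA : ¬ ∃ R : Matrix (Fin l) (Fin k) ℝ, A * R = 1) :
    ∃ u, u ≠ 0 ∧ A *ᵥ u = 0 :=
  (exists_left_inv_or_mulVec_eq_zero A).resolve_left fun ⟨L, hL⟩ =>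
    hA ⟨L, right_inv_of_left_inv hL hkl⟩

theorem lossGrad_transpose_mul_seg_eq_zero {W : Weights d}
    (hW : IsLocalMin (fun W : Weights d => loss X Y (seg W 0 h)) W) {q : ℕ} (hq : 0 < q)
    (hqh : q ≤ h) (hd : ∀ j, 0 < j → j < q → d 0 ≤ d j) :
    (lossGrad X Y (seg W 0 h))ᵀ * seg W q h = 0 := by
  classical
  let P : ℕ → Prop := fun a => ∃ L : Matrix (Fin (d 0)) (Fin (d a)) ℝ, L * seg W 0 a = 1
  have hP0 : P 0 := ⟨1, by rw [seg_self, Matrix.mul_one]⟩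
  obtain ⟨L, hL⟩ : P (Nat.findGreatest P (q - 1)) := Nat.findGreatest_spec (Nat.zero_le _) hP0
  have hmax (i : ℕ) (hi : Nat.findGreatest P (q - 1) < i) (hiq : i ≤ q - 1) : ¬ P i :=
    Nat.findGreatest_is_greatest hi hiq
  have hle : Nat.findGreatest P (q - 1) ≤ q - 1 := Nat.findGreatest_le _
  generalize Nat.findGreatest P (q - 1) = a at *
  refine eq_zero_of_left_kernels (W := W) (a := a + 1) (b := q) (by omega)
    (fun i hi hiq => exists_vecMul_eq_zero_of_not_left_inv (hd i (by omega) hiq)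
      (hmax i (by omega) (by omega))) ?_
  filter_upwards [eventually_isLocalMin_of_seg_eq hW] with W' hW' hseg hout
  have h1 := seg_mul_lossGrad_mul_seg_eq_zero (hW' (hseg h)) (i := a) (by omega)
  rw [hseg, hseg] at h1
  rw [← seg_congr hqh (W := W') fun i hi _ => hout i hi, Matrix.mul_assoc,
    seg_mul_seg W' (by omega) hqh]
  calc _ = L * seg W 0 a * (lossGrad X Y (seg W 0 h))ᵀ * seg W' (a + 1) h := by
        rw [hL, Matrix.one_mul]
    _ = L * (seg W 0 a * (lossGrad X Y (seg W 0 h))ᵀ * seg W' (a + 1) h) := by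
        simp only [Matrix.mul_assoc]
    _ = 0 := by rw [h1, Matrix.mul_zero]

theorem seg_mul_lossGrad_transpose_eq_zero {W : Weights d}
    (hW : IsLocalMin (fun W : Weights d => loss X Y (seg W 0 h)) W) {q : ℕ} (hqh : q < h)
    (hd : ∀ j, q < j → j < h → d h ≤ d j) :
    seg W 0 q * (lossGrad X Y (seg W 0 h))ᵀ = 0 := by
  classical
  have hex : ∃ c, q < c ∧ c ≤ h ∧ ∃ R : Matrix (Fin (d c)) (Fin (d h)) ℝ, seg W c h * R = 1 :=
    ⟨h, hqh, le_rfl, 1, by rw [seg_self, Matrix.mul_one]⟩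
  obtain ⟨hqc, hch, R, hR⟩ := Nat.find_spec hex
  have hmin (i : ℕ) (hi : i < Nat.find hex) := Nat.find_min hex hi
  generalize Nat.find hex = c at *
  obtain ⟨b, rfl⟩ : ∃ b, c = b + 1 := ⟨c - 1, by omega⟩
  refine eq_zero_of_right_kernels (W := W) (a := q) (b := b) (h := h) (by omega) (by omega)
    (fun i hi hib => exists_mulVec_eq_zero_of_not_right_inv (hd i hi (by omega))
      fun hr => hmin i (by omega) ⟨hi, by omega, hr⟩) ?_
  filter_upwards [eventually_isLocalMin_of_seg_eq hW] with W' hW' hseg hout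
  have h1 := seg_mul_lossGrad_mul_seg_eq_zero (hW' (hseg 0 h.zero_le)) (i := b) (by omega)
  rw [hseg 0 h.zero_le, hseg _ hch] at h1
  rw [← seg_congr q.zero_le (W := W') fun i _ hi => hout i hi, ← Matrix.mul_assoc,
    seg_mul_seg W' q.zero_le (by omega)]
  calc _ = seg W' 0 b * (lossGrad X Y (seg W 0 h))ᵀ * (seg W (b + 1) h * R) := by
        rw [hR, Matrix.mul_one]
    _ = 0 := by rw [← Matrix.mul_assoc, h1, Matrix.zero_mul]

theorem lossGrad_eq_zero_of_left_kernels {W : Weights d}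
    (hW : IsLocalMin (fun W : Weights d => loss X Y (seg W 0 h)) W) {q : ℕ} (hq : 0 < q)
    (hqh : q ≤ h) (hd : ∀ j, 0 < j → j < q → d 0 ≤ d j)
    (hker : ∀ i, q ≤ i → i < h → ∃ w, w ≠ 0 ∧ w ᵥ* seg W 0 i = 0) :
    lossGrad X Y (seg W 0 h) = 0 := by
  rw [← transpose_eq_zero]
  refine eq_zero_of_left_kernels hqh hker ?_
  filter_upwards [eventually_isLocalMin_of_seg_eq hW] with W' hW' hseg _
  rw [← hseg]
  exact lossGrad_transpose_mul_seg_eq_zero (hW' (hseg h)) hq hqh hd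

theorem lossGrad_eq_zero_of_right_kernels {W : Weights d}
    (hW : IsLocalMin (fun W : Weights d => loss X Y (seg W 0 h)) W) {q : ℕ}
    (hqh : q < h) (hd : ∀ j, q < j → j < h → d h ≤ d j)
    (hker : ∀ j, 0 < j → j ≤ q → ∃ u, u ≠ 0 ∧ seg W j h *ᵥ u = 0) :
    lossGrad X Y (seg W 0 h) = 0 := by
  rw [← transpose_eq_zero]
  refine eq_zero_of_right_kernels q.zero_le hqh.le hker ?_
  filter_upwards [eventually_isLocalMin_of_seg_eq hW] with W' hW' hseg _
  rw [← hseg 0 h.zero_le]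
  exact seg_mul_lossGrad_transpose_eq_zero (hW' (hseg 0 h.zero_le)) hqh hd

/-- A local minimum moves the factors of `seg W q h * seg W 0 q` independently when they have
one-sided inverses, so it satisfies the second-order condition of the two-layer problem. -/
theorem second_order_of_left_inv_of_right_inv {W : Weights d}
    (hW : IsLocalMin (fun W : Weights d => loss X Y (seg W 0 h)) W) {q : ℕ} (hq : 0 < q)
    (hqh : q < h) {L : Matrix (Fin (d q)) (Fin (d h)) ℝ} (hL : L * seg W q h = 1)
    {R : Matrix (Fin (d 0)) (Fin (d q)) ℝ} (hR : seg W 0 q * R = 1)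
    (hA : (lossGrad X Y (seg W 0 h))ᵀ * seg W q h = 0)
    (hB : seg W 0 q * (lossGrad X Y (seg W 0 h))ᵀ = 0)
    (a : Matrix (Fin (d h)) (Fin (d q)) ℝ) (b : Matrix (Fin (d q)) (Fin (d 0)) ℝ) :
    0 ≤ trace ((lossGrad X Y (seg W 0 h))ᵀ * (a * b)) + (1 / 2) *
      trace (((a * seg W 0 q + seg W q h * b) * X)ᵀ * ((a * seg W 0 q + seg W q h * b) * X)) := by
  obtain ⟨k, rfl⟩ : ∃ k, h = k + 1 := ⟨h - 1, by omega⟩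
  have hqk : q ≤ k := by omega
  have hk : k ≠ 0 := by omega
  set G := lossGrad X Y (seg W 0 (k + 1)) with hG
  set A := seg W q (k + 1) with hAdef
  set B := seg W 0 q with hBdef
  let U : ℝ → Weights d := fun t => addLayer W k (t • (a * (L * W k)))
  let V : ℝ → Weights d := fun t => addLayer (U t) 0 (t • (W 0 * R * b))
  have hU : Continuous U := continuous_const.update k (by fun_prop)
  have hV : Continuous V := hU.update 0 (by fun_prop)
  have hV0 : V 0 = W := by simp [V, U, addLayer]
  have hVA (t : ℝ) : seg (V t) q (k + 1) = A + t • a := by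
    rw [seg_addLayer_of_lt _ (by omega) hq, seg_addLayer W hqk k.lt_succ_self, seg_self,
      Matrix.one_mul, Matrix.smul_mul, Matrix.mul_assoc, Matrix.mul_assoc, ← seg_succ W hqk, hL,
      Matrix.mul_one]
  have hVB (t : ℝ) : seg (V t) 0 q = B + t • b := by
    rw [seg_addLayer _ le_rfl hq, seg_addLayer_of_le W q.zero_le hqk,
      seg_addLayer_of_le W hq hqk, seg_self, Matrix.mul_one, Matrix.mul_smul, Matrix.mul_assoc,
      ← Matrix.mul_assoc, ← Matrix.mul_assoc, seg_succ_mul W hq, hR, Matrix.one_mul]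
  let Z : ℝ → Matrix (Fin (d (k + 1))) (Fin (d 0)) ℝ := fun t => a * B + A * b + t • (a * b)
  have hseg (t : ℝ) : seg (V t) 0 (k + 1) = seg W 0 (k + 1) + t • Z t := by
    rw [← seg_mul_seg _ q.zero_le hqh.le, hVA, hVB, ← seg_mul_seg W q.zero_le hqh.le]
    simp only [Z, Matrix.add_mul, Matrix.mul_add, Matrix.smul_mul, Matrix.mul_smul, smul_add,
      ← hAdef, ← hBdef]
    abel
  have htrace (t : ℝ) : trace (Gᵀ * Z t) = t * trace (Gᵀ * (a * b)) := by
    have h1 : trace (Gᵀ * (a * B)) = 0 := by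
      rw [← Matrix.mul_assoc, trace_mul_comm, ← Matrix.mul_assoc, hB, Matrix.zero_mul, trace_zero]
    simp only [Z]
    rw [Matrix.mul_add, Matrix.mul_add, trace_add, trace_add, h1, ← Matrix.mul_assoc Gᵀ A, hA,
      Matrix.zero_mul, trace_zero, Matrix.mul_smul, trace_smul, smul_eq_mul]
    ring
  have hcont : Continuous fun t =>
      trace (Gᵀ * (a * b)) + (1 / 2) * trace ((Z t * X)ᵀ * (Z t * X)) := by
    fun_prop
  have hlim := (hcont.tendsto 0).mono_left (nhdsWithin_le_nhds (s := {0}ᶜ))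
  simp only [Z, zero_smul, add_zero] at hlim
  refine ge_of_tendsto hlim ?_
  have hVW := hV.tendsto 0
  rw [hV0] at hVW
  filter_upwards [(hVW.eventually hW).filter_mono (nhdsWithin_le_nhds (s := {0}ᶜ)),
    self_mem_nhdsWithin] with t ht ht0
  rw [hseg, loss_add, ← hG, Matrix.mul_smul, trace_smul, smul_eq_mul, htrace] at ht
  simp only [Matrix.smul_mul, Matrix.mul_smul, transpose_smul, trace_smul, smul_eq_mul] at ht
  have ht2 : 0 < t ^ 2 := sq_pos_of_ne_zero ht0
  refine nonneg_of_mul_nonneg_right (?_ : 0 ≤ t ^ 2 * _) ht2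
  simp only [Z] at ht
  linarith

/-- A local minimum is global if the widths up to some `q` are at least the input width and those
after `q` are at least the output width. -/
theorem loss_seg_le_of_isLocalMin {W : Weights d}
    (hW : IsLocalMin (fun W : Weights d => loss X Y (seg W 0 h)) W) {q : ℕ} (hq : 0 < q)
    (hqh : q < h) (hd0 : ∀ j, 0 < j → j < q → d 0 ≤ d j) (hdh : ∀ j, q < j → j < h → d h ≤ d j)
    (W' : Weights d) : loss X Y (seg W 0 h) ≤ loss X Y (seg W' 0 h) := by
  by_cases hG : lossGrad X Y (seg W 0 h) = 0
  · exact loss_le_of_lossGrad_eq_zero hG _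
  have hA := lossGrad_transpose_mul_seg_eq_zero hW hq hqh.le hd0
  have hB := seg_mul_lossGrad_transpose_eq_zero hW hqh hdh
  have key {L : Matrix (Fin (d q)) (Fin (d h)) ℝ} (hL : L * seg W q h = 1)
      {R : Matrix (Fin (d 0)) (Fin (d q)) ℝ} (hR : seg W 0 q * R = 1) :
      loss X Y (seg W 0 h) ≤ loss X Y (seg W' 0 h) := by
    have h2 := second_order_of_left_inv_of_right_inv hW hq hqh hL hR hA hB
    rw [← seg_mul_seg W' q.zero_le hqh.le]
    rw [← seg_mul_seg W q.zero_le hqh.le] at hA hB h2 ⊢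
    refine loss_mul_le_of_second_order hL ?_ ?_ h2 _ _
    · simpa using congrArg transpose hA
    · simpa using congrArg transpose hB
  obtain ⟨i, hqi, hih, R, hR⟩ : ∃ i, q ≤ i ∧ i < h ∧
      ∃ R : Matrix (Fin (d 0)) (Fin (d i)) ℝ, seg W 0 i * R = 1 := by
    by_contra! hcon
    exact hG (lossGrad_eq_zero_of_left_kernels hW hq hqh.le hd0 fun i hi hih =>
      (exists_right_inv_or_vecMul_eq_zero _).resolve_left fun ⟨R, hR⟩ => hcon i hi hih R hR)
  obtain ⟨j, hj, hjq, L, hL⟩ : ∃ j, 0 < j ∧ j ≤ q ∧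
      ∃ L : Matrix (Fin (d j)) (Fin (d h)) ℝ, L * seg W j h = 1 := by
    by_contra! hcon
    exact hG (lossGrad_eq_zero_of_right_kernels hW hqh hdh fun j hj hjq =>
      (exists_left_inv_or_mulVec_eq_zero _).resolve_left fun ⟨L, hL⟩ => hcon j hj hjq L hL)
  rcases hqi.eq_or_lt with rfl | hqi
  · rw [← seg_mul_seg W hjq hqh.le, ← Matrix.mul_assoc] at hL
    have h1 := hR
    rw [← seg_mul_seg W j.zero_le hjq, Matrix.mul_assoc] at h1
    have h2 : L * seg W q h = seg W 0 j * R := by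
      rw [← Matrix.mul_one (L * _), ← h1, ← Matrix.mul_assoc, hL, Matrix.one_mul]
    refine key (L := seg W j q * L) ?_ hR
    rw [Matrix.mul_assoc, h2, h1]
  rcases hjq.eq_or_lt with rfl | hjq
  · rw [← seg_mul_seg W j.zero_le hqi.le, Matrix.mul_assoc] at hR
    have h1 := hL
    rw [← seg_mul_seg W hqi.le hih.le, ← Matrix.mul_assoc] at h1
    have h2 : L * seg W i h = seg W 0 j * R := by
      rw [← Matrix.mul_one (L * _), ← hR, ← Matrix.mul_assoc, h1, Matrix.one_mul]
    refine key hL (R := R * seg W j i) ?_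
    rw [← Matrix.mul_assoc, ← h2, h1]
  · have h1 := le_of_right_inv hR
    have h2 := hd0 j hj hjq
    have h3 := hdh i hqi hih
    refine absurd ?_ hG
    rw [← transpose_eq_zero, ← Matrix.mul_one (_ᵀ),
      ← right_inv_of_left_inv hL (h3.trans (h1.trans h2)), ← seg_mul_seg W hjq.le hqh.le,
      ← Matrix.mul_assoc, ← Matrix.mul_assoc, hA, Matrix.zero_mul, Matrix.zero_mul]

end Network

/-- If there are NO indices `1 ≤ p1 < p2 ≤ h − 1` with `d_h > d_{p2}` and
`d_0 > d_{p1}`, then for every `n ≥ 1` and all `X`, `Y`, every local minimum of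
`f(W) = (1/2)·‖W_h ⋯ W_1·X − Y‖²` is a global minimum. -/
theorem statement_12 (h : ℕ) (hh : 1 ≤ h) (d : ℕ → ℕ)
    (hno : ¬ ∃ p1 p2 : ℕ, 1 ≤ p1 ∧ p1 < p2 ∧ p2 + 1 ≤ h ∧ d p2 < d h ∧ d p1 < d 0) :
    ∀ n : ℕ, 1 ≤ n →
      ∀ (X : Matrix (Fin (d 0)) (Fin n) ℝ) (Y : Matrix (Fin (d h)) (Fin n) ℝ)
        (W₀ : (i : ℕ) → Matrix (Fin (d (i + 1))) (Fin (d i)) ℝ),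
        (∃ ε > 0, ∀ W : (i : ℕ) → Matrix (Fin (d (i + 1))) (Fin (d i)) ℝ,
          (∀ i < h, frob (W i - W₀ i) < ε) →
            (1 / 2) * frob (chainProd d W₀ h * X - Y) ^ 2 ≤
              (1 / 2) * frob (chainProd d W h * X - Y) ^ 2) →
        ∀ W : (i : ℕ) → Matrix (Fin (d (i + 1))) (Fin (d i)) ℝ,
          (1 / 2) * frob (chainProd d W₀ h * X - Y) ^ 2 ≤
            (1 / 2) * frob (chainProd d W h * X - Y) ^ 2 := by
  intro n _ X Y W₀ ⟨ε, hε, hmin⟩ W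
  rw [chainProd_eq_seg, chainProd_eq_seg]
  have hW : IsLocalMin (fun W : Weights d => loss X Y (seg W 0 h)) W₀ := by
    have hnear : ∀ᶠ W : Weights d in 𝓝 W₀, ∀ i ∈ Finset.range h, frob (W i - W₀ i) < ε := by
      refine (Filter.eventually_all_finset _).mpr fun i _ => ?_
      have hc : Continuous fun W : Weights d => frob (W i - W₀ i) := by
        unfold frob
        have hc (k : Fin (d (i + 1))) (l : Fin (d i)) : Continuous fun W : Weights d => W i k l :=
          (continuous_apply i).matrix_elem k l
        simp only [Matrix.sub_apply]
        fun_prop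
      exact hc.continuousAt.eventually_lt continuousAt_const (by simpa [frob] using hε)
    filter_upwards [hnear] with W' hW'
    simpa only [loss, chainProd_eq_seg] using hmin W' fun i hi => hW' i (Finset.mem_range.mpr hi)
  change loss X Y (seg W₀ 0 h) ≤ loss X Y (seg W 0 h)
  by_cases hp : ∃ p, 0 < p ∧ p < h ∧ d p < d 0
  · classical
    obtain ⟨hq, hqh, hdq⟩ := Nat.find_spec hp
    refine loss_seg_le_of_isLocalMin hW hq hqh (fun j hj hjq => ?_) (fun j hqj hjh => ?_) W
    · by_contra! hlt
      exact Nat.find_min hp hjq ⟨hj, hjq.trans hqh, hlt⟩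
    · by_contra! hlt
      exact hno ⟨_, j, hq, hqj, hjh, hlt, hdq⟩
  · push Not at hp
    have hG := lossGrad_transpose_mul_seg_eq_zero hW hh le_rfl hp
    rw [seg_self, Matrix.mul_one, transpose_eq_zero] at hG
    exact loss_le_of_lossGrad_eq_zero hG _
end

section
/- Let ℓ : ℝ^{dh×n} → ℝ be convex and differentiable, let X ∈ ℝ^{d0×n}, and consider the objective f(W_h, …, W_1) = ℓ(W_h···W_1·X) with Wᵢ ∈ ℝ^{dᵢ×d_{i−1}}. Assume min over 0 ≤ i ≤ h of dᵢ equals min(d_h, d_0). Then: (a) every non-degenerate critical point of f (a point where the gradient of f vanishes and rank(W_h···W_1) = min over i of dᵢ) is a global minimum of f; and (b) every degenerate critical point of f (gradient zero and rank(W_h···W_1) < min over i of dᵢ) is either a global minimum of f or not a local minimum of f. -/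
open Matrix

attribute [local instance] Matrix.frobeniusNormedAddCommGroup Matrix.frobeniusNormedSpace

section MatrixAux

variable {m n k : ℕ}

/-- A matrix of full row rank has a right inverse. -/
theorem exists_mul_eq_one_of_rank_eq {P : Matrix (Fin m) (Fin n) ℝ} (hP : P.rank = m) :
    ∃ R : Matrix (Fin n) (Fin m) ℝ, P * R = 1 := by
  rw [← mulVec_surjective_iff_exists_right_inverse]
  have h : LinearMap.range P.mulVecLin = ⊤ :=
    Submodule.eq_top_of_finrank_eq (by rw [Module.finrank_fin_fun]; exact hP)
  exact LinearMap.range_eq_top.mp h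

/-- A matrix of full column rank has a left inverse. -/
theorem exists_mul_eq_one_of_rank_eq' {P : Matrix (Fin m) (Fin n) ℝ} (hP : P.rank = n) :
    ∃ L : Matrix (Fin n) (Fin m) ℝ, L * P = 1 := by
  obtain ⟨R, hR⟩ := exists_mul_eq_one_of_rank_eq ((rank_transpose P).trans hP)
  exact ⟨Rᵀ, by simpa using congrArg transpose hR⟩

/-- A matrix with at least as many columns as rows has a right inverse or a null vector. -/
theorem exists_mul_eq_one_or_mulVec_eq_zero (hmn : m ≤ n) (P : Matrix (Fin m) (Fin n) ℝ) :
    (∃ R : Matrix (Fin n) (Fin m) ℝ, P * R = 1) ∨ ∃ b : Fin n → ℝ, b ≠ 0 ∧ P *ᵥ b = 0 := by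
  by_cases hP : P.rank = m
  · exact Or.inl (exists_mul_eq_one_of_rank_eq hP)
  · right
    by_contra! hb
    have hker : LinearMap.ker P.mulVecLin = ⊥ :=
      (Submodule.eq_bot_iff _).mpr fun b hb' => by_contra fun h0 => hb b h0 hb'
    have hsum := LinearMap.finrank_range_add_finrank_ker P.mulVecLin
    rw [hker, finrank_bot, Module.finrank_fin_fun, add_zero] at hsum
    have hle := P.rank_le_height
    have hrk : P.rank = n := hsum
    omega

/-- A matrix with at least as many rows as columns has a left inverse or a left null vector. -/
theorem exists_mul_eq_one_or_vecMul_eq_zero (hnm : n ≤ m) (P : Matrix (Fin m) (Fin n) ℝ) :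
    (∃ L : Matrix (Fin n) (Fin m) ℝ, L * P = 1) ∨ ∃ u : Fin m → ℝ, u ≠ 0 ∧ u ᵥ* P = 0 := by
  rcases exists_mul_eq_one_or_mulVec_eq_zero hnm Pᵀ with ⟨R, hR⟩ | ⟨b, hb0, hb⟩
  · exact Or.inl ⟨Rᵀ, by simpa using congrArg transpose hR⟩
  · exact Or.inr ⟨b, hb0, by rwa [mulVec_transpose] at hb⟩

theorem eq_sum_vecMulVec_mul_vecMulVec_left {u : Fin n → ℝ} (hu : u ≠ 0)
    (C : Matrix (Fin m) (Fin k) ℝ) :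
    C = ∑ j, vecMulVec (fun i => C i j) u * vecMulVec ((u ⬝ᵥ u)⁻¹ • u) (Pi.single j 1) := by
  have h0 : u ⬝ᵥ u ≠ 0 := fun h => hu (dotProduct_self_eq_zero.mp h)
  ext a b
  simp [Matrix.sum_apply, vecMulVec_mul_vecMulVec, h0, vecMulVec_apply, Pi.single_apply]

theorem eq_sum_vecMulVec_mul_vecMulVec_right {b : Fin n → ℝ} (hb : b ≠ 0)
    (C : Matrix (Fin m) (Fin k) ℝ) :
    C = ∑ i, vecMulVec (Pi.single i 1) ((b ⬝ᵥ b)⁻¹ • b) * vecMulVec b (C i) := by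
  have h0 : b ⬝ᵥ b ≠ 0 := fun h => hb (dotProduct_self_eq_zero.mp h)
  ext a c
  simp [Matrix.sum_apply, vecMulVec_mul_vecMulVec, h0, vecMulVec_apply, Pi.single_apply]

theorem frob_zero : frob (0 : Matrix (Fin m) (Fin n) ℝ) = 0 := by
  simp [frob]

theorem eventually_frob_add_smul_lt {ε : ℝ} {A : Matrix (Fin m) (Fin n) ℝ} (hA : frob A < ε)
    (E : Matrix (Fin m) (Fin n) ℝ) : ∀ᶠ t : ℝ in nhds 0, frob (A + t • E) < ε := by
  have hc : Continuous fun t : ℝ => frob (A + t • E) := by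
    simp only [frob, Matrix.add_apply, Matrix.smul_apply, smul_eq_mul]
    fun_prop
  refine hc.continuousAt.eventually_lt continuousAt_const ?_
  simpa using hA

end MatrixAux

/-- The product `W_{p-1} ⋯ W_j` of consecutive layers; for `p ≤ j` it is a rectangular identity. -/
noncomputable def segProd (d : ℕ → ℕ)
    (W : (i : ℕ) → Matrix (Fin (d (i + 1))) (Fin (d i)) ℝ) (j : ℕ) :
    (p : ℕ) → Matrix (Fin (d p)) (Fin (d j)) ℝ
  | 0 => Matrix.of fun a b => if (a : ℕ) = b then 1 else 0
  | (p + 1) =>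
    if p + 1 ≤ j then Matrix.of fun a b => if (a : ℕ) = b then 1 else 0
    else W p * segProd d W j p

section SegProd

variable {d : ℕ → ℕ} {W W' : (i : ℕ) → Matrix (Fin (d (i + 1))) (Fin (d i)) ℝ}

theorem segProd_self (W : (i : ℕ) → Matrix (Fin (d (i + 1))) (Fin (d i)) ℝ) (j : ℕ) :
    segProd d W j j = 1 := by
  cases j <;> ext a b <;> simp [segProd, Matrix.one_apply, Fin.ext_iff]

theorem segProd_succ (W : (i : ℕ) → Matrix (Fin (d (i + 1))) (Fin (d i)) ℝ) {j p : ℕ}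
    (hjp : j ≤ p) : segProd d W j (p + 1) = W p * segProd d W j p := by
  rw [segProd, if_neg (by omega)]

theorem segProd_eq_mul (W : (i : ℕ) → Matrix (Fin (d (i + 1))) (Fin (d i)) ℝ) {j p : ℕ}
    (hjp : j < p) : segProd d W j p = segProd d W (j + 1) p * W j := by
  induction p, hjp using Nat.le_induction with
  | base => rw [segProd_succ W le_rfl, segProd_self, segProd_self, Matrix.one_mul, Matrix.mul_one]
  | succ p hp ih =>
    rw [segProd_succ W hp, segProd_succ W (by omega), ih, Matrix.mul_assoc]

theorem chainProd_eq_segProd (W : (i : ℕ) → Matrix (Fin (d (i + 1))) (Fin (d i)) ℝ) (p : ℕ) :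
    chainProd d W p = segProd d W 0 p := by
  induction p with
  | zero => rw [segProd_self]; rfl
  | succ p ih => rw [segProd_succ W (Nat.zero_le p), ← ih]; rfl

theorem segProd_zero_eq_mul_mul (W : (i : ℕ) → Matrix (Fin (d (i + 1))) (Fin (d i)) ℝ) {i p : ℕ}
    (hip : i < p) :
    segProd d W 0 p = segProd d W (i + 1) p * W i * segProd d W 0 i := by
  induction p, hip using Nat.le_induction with
  | base => rw [segProd_succ W (Nat.zero_le i), segProd_self, Matrix.one_mul]
  | succ p hp ih =>
    rw [segProd_succ W (Nat.zero_le p), segProd_succ W hp, ih]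
    simp only [Matrix.mul_assoc]

theorem segProd_congr {j p : ℕ} (hjp : j ≤ p) (hW : ∀ i, j ≤ i → i < p → W i = W' i) :
    segProd d W j p = segProd d W' j p := by
  induction p, hjp using Nat.le_induction with
  | base => rw [segProd_self, segProd_self]
  | succ p hp ih =>
    rw [segProd_succ W hp, segProd_succ W' hp, hW p hp p.lt_succ_self,
      ih fun i hi hip => hW i hi (by omega)]

theorem segProd_update_of_lt (W : (i : ℕ) → Matrix (Fin (d (i + 1))) (Fin (d i)) ℝ) {i j p : ℕ}
    (hjp : j ≤ p) (hij : i < j) (B : Matrix (Fin (d (i + 1))) (Fin (d i)) ℝ) :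
    segProd d (Function.update W i B) j p = segProd d W j p :=
  segProd_congr hjp fun q _ _ => Function.update_of_ne (by omega) _ _

theorem segProd_update_of_le (W : (i : ℕ) → Matrix (Fin (d (i + 1))) (Fin (d i)) ℝ) {i j p : ℕ}
    (hjp : j ≤ p) (hpi : p ≤ i) (B : Matrix (Fin (d (i + 1))) (Fin (d i)) ℝ) :
    segProd d (Function.update W i B) j p = segProd d W j p :=
  segProd_congr hjp fun q _ _ => Function.update_of_ne (by omega) _ _

theorem segProd_update_add_smul (W : (i : ℕ) → Matrix (Fin (d (i + 1))) (Fin (d i)) ℝ) {i p : ℕ}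
    (hip : i < p) (t : ℝ) (A : Matrix (Fin (d (i + 1))) (Fin (d i)) ℝ) :
    segProd d (Function.update W i (W i + t • A)) 0 p =
      segProd d W 0 p + t • (segProd d W (i + 1) p * A * segProd d W 0 i) := by
  rw [segProd_zero_eq_mul_mul _ hip, segProd_update_of_lt W hip i.lt_succ_self,
    segProd_update_of_le W (Nat.zero_le i) le_rfl, Function.update_self,
    segProd_zero_eq_mul_mul W hip, Matrix.mul_add, Matrix.add_mul, Matrix.mul_smul,
    Matrix.smul_mul]

/-- Changing every layer only off the image of the preceding ones keeps all partial products. -/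
theorem segProd_zero_eq_of_mul_eq {p h : ℕ} (hp : p ≤ h)
    (hW : ∀ i < h, W' i * segProd d W 0 i = W i * segProd d W 0 i) :
    segProd d W' 0 p = segProd d W 0 p := by
  induction p with
  | zero => rw [segProd_self, segProd_self]
  | succ p ih =>
    rw [segProd_succ W (Nat.zero_le p), segProd_succ W' (Nat.zero_le p), ih (by omega),
      hW p (by omega)]

/-- Changing every layer only inside the kernel of the following ones keeps all partial
products. -/
theorem segProd_eq_of_mul_eq {j h : ℕ} (hj : j ≤ h)
    (hW : ∀ i < h, segProd d W (i + 1) h * W' i = segProd d W (i + 1) h * W i) :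
    segProd d W' j h = segProd d W j h := by
  induction hj using Nat.decreasingInduction with
  | self => rw [segProd_self, segProd_self]
  | of_succ j hj ih => rw [segProd_eq_mul W hj, segProd_eq_mul W' hj, ih, hW j hj]

theorem forall_frob_update_lt {W₀ : (i : ℕ) → Matrix (Fin (d (i + 1))) (Fin (d i)) ℝ} {h : ℕ}
    {ε : ℝ} (hW : ∀ i < h, frob (W i - W₀ i) < ε) {j : ℕ}
    {B : Matrix (Fin (d (j + 1))) (Fin (d j)) ℝ} (hB : frob (B - W₀ j) < ε) :
    ∀ i < h, frob (Function.update W j B i - W₀ i) < ε := by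
  intro i hi
  rcases eq_or_ne i j with rfl | hij
  · rwa [Function.update_self]
  · rw [Function.update_of_ne hij]
    exact hW i hi

theorem eventually_forall_frob_update_lt
    {W₀ : (i : ℕ) → Matrix (Fin (d (i + 1))) (Fin (d i)) ℝ} {h : ℕ} {ε : ℝ}
    (hW : ∀ i < h, frob (W i - W₀ i) < ε) {j : ℕ} (hj : j < h)
    (E : Matrix (Fin (d (j + 1))) (Fin (d j)) ℝ) :
    ∀ᶠ t : ℝ in nhds 0,
      ∀ i < h, frob (Function.update W j (W j + t • E) i - W₀ i) < ε := by
  filter_upwards [eventually_frob_add_smul_lt (hW j hj) E] with t ht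
  refine forall_frob_update_lt hW ?_
  rwa [add_sub_right_comm]

theorem exists_ne_zero_forall_frob_update_lt
    {W₀ : (i : ℕ) → Matrix (Fin (d (i + 1))) (Fin (d i)) ℝ} {h : ℕ} {ε : ℝ}
    (hW : ∀ i < h, frob (W i - W₀ i) < ε) {j : ℕ} (hj : j < h)
    (E : Matrix (Fin (d (j + 1))) (Fin (d j)) ℝ) :
    ∃ t : ℝ, t ≠ 0 ∧
      ∀ i < h, frob (Function.update W j (W j + t • E) i - W₀ i) < ε := by
  obtain ⟨t, ht, ht0⟩ := (((eventually_forall_frob_update_lt hW hj E).filter_mono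
    nhdsWithin_le_nhds).and (self_mem_nhdsWithin (s := {(0 : ℝ)}ᶜ))).exists
  exact ⟨t, ht0, ht⟩

end SegProd

section Fiber

variable {d : ℕ → ℕ} {W₀ : (i : ℕ) → Matrix (Fin (d (i + 1))) (Fin (d i)) ℝ} {h : ℕ} {ε : ℝ}
  {T : Matrix (Fin (d h)) (Fin (d 0)) ℝ →ₗ[ℝ] ℝ}

/-- If the input width is minimal and the linear functional `T` annihilates the tangent directions
at every nearby point of the fiber of `W₀`, then `T = 0`. -/
theorem eq_zero_of_forall_fiber_of_input_le (hh : 1 ≤ h) (hε : 0 < ε)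
    (hd : ∀ j ≤ h, d 0 ≤ d j)
    (hT : ∀ W : (i : ℕ) → Matrix (Fin (d (i + 1))) (Fin (d i)) ℝ,
      (∀ i < h, frob (W i - W₀ i) < ε) → segProd d W 0 h = segProd d W₀ 0 h →
      ∀ i < h, ∀ A : Matrix (Fin (d (i + 1))) (Fin (d i)) ℝ,
        T (segProd d W (i + 1) h * A * segProd d W 0 i) = 0)
    (C : Matrix (Fin (d h)) (Fin (d 0)) ℝ) : T C = 0 := by
  have key : ∀ j ≤ h, j = 0 ∨ ∀ W : (i : ℕ) → Matrix (Fin (d (i + 1))) (Fin (d i)) ℝ,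
      (∀ i < h, frob (W i - W₀ i) < ε) →
      (∀ i < h, W i * segProd d W₀ 0 i = W₀ i * segProd d W₀ 0 i) →
      ∀ B : Matrix (Fin (d j)) (Fin (d 0)) ℝ, T (segProd d W j h * B) = 0 := by
    intro j
    induction j with
    | zero => exact fun _ => Or.inl rfl
    | succ j ih =>
      refine fun hj => Or.inr fun W hW hWf B => ?_
      rcases exists_mul_eq_one_or_vecMul_eq_zero (hd j (by omega)) (segProd d W₀ 0 j) with
        ⟨L, hL⟩ | ⟨u, hu0, hu⟩
      · have h1 := hT W hW (segProd_zero_eq_of_mul_eq le_rfl hWf) j hj (B * L)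
        rwa [segProd_zero_eq_of_mul_eq (by omega) hWf, Matrix.mul_assoc, Matrix.mul_assoc, hL,
          Matrix.mul_one] at h1
      · rcases ih (by omega) with rfl | ih
        · rw [segProd_self, Matrix.vecMul_one] at hu
          exact absurd hu hu0
        rw [eq_sum_vecMulVec_mul_vecMulVec_left hu0 B, Matrix.mul_sum, map_sum]
        refine Finset.sum_eq_zero fun c _ => ?_
        generalize vecMulVec ((u ⬝ᵥ u)⁻¹ • u) (Pi.single c 1) = D
        generalize (fun i => B i c) = w
        obtain ⟨t, ht0, ht⟩ := exists_ne_zero_forall_frob_update_lt hW hj (vecMulVec w u)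
        have h1 := ih _ ht (fun i hi => by
          rcases eq_or_ne i j with rfl | hij
          · have hE : vecMulVec w u * segProd d W₀ 0 i = 0 := by
              rw [vecMulVec_mul, hu]
              ext
              simp [vecMulVec_apply]
            rw [Function.update_self, Matrix.add_mul, Matrix.smul_mul, hE, smul_zero, add_zero,
              hWf i hi]
          · rw [Function.update_of_ne hij, hWf i hi]) D
        have h2 := ih W hW hWf D
        rw [segProd_eq_mul _ hj, segProd_update_of_lt W hj j.lt_succ_self, Function.update_self,
          Matrix.mul_add, Matrix.add_mul, ← segProd_eq_mul W hj, map_add, h2, zero_add,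
          Matrix.mul_smul, Matrix.smul_mul, map_smul, smul_eq_mul] at h1
        rw [← Matrix.mul_assoc]
        exact (mul_eq_zero.mp h1).resolve_left ht0
  have h1 := ((key h le_rfl).resolve_left (by omega)) W₀ (by simpa [frob_zero] using fun _ _ => hε)
    (fun _ _ => rfl) C
  rwa [segProd_self, Matrix.one_mul] at h1

/-- If the output width is minimal and the linear functional `T` annihilates the tangent directions
at every nearby point of the fiber of `W₀`, then `T = 0`. -/
theorem eq_zero_of_forall_fiber_of_output_le (hh : 1 ≤ h) (hε : 0 < ε)
    (hd : ∀ j ≤ h, d h ≤ d j)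
    (hT : ∀ W : (i : ℕ) → Matrix (Fin (d (i + 1))) (Fin (d i)) ℝ,
      (∀ i < h, frob (W i - W₀ i) < ε) → segProd d W 0 h = segProd d W₀ 0 h →
      ∀ i < h, ∀ A : Matrix (Fin (d (i + 1))) (Fin (d i)) ℝ,
        T (segProd d W (i + 1) h * A * segProd d W 0 i) = 0)
    (C : Matrix (Fin (d h)) (Fin (d 0)) ℝ) : T C = 0 := by
  have key : ∀ j ≤ h, j = h ∨ ∀ W : (i : ℕ) → Matrix (Fin (d (i + 1))) (Fin (d i)) ℝ,
      (∀ i < h, frob (W i - W₀ i) < ε) →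
      (∀ i < h, segProd d W₀ (i + 1) h * W i = segProd d W₀ (i + 1) h * W₀ i) →
      ∀ B : Matrix (Fin (d h)) (Fin (d j)) ℝ, T (B * segProd d W 0 j) = 0 := by
    intro j hj
    induction hj using Nat.decreasingInduction with
    | self => exact Or.inl rfl
    | of_succ j hj ih =>
      refine Or.inr fun W hW hWf B => ?_
      rcases exists_mul_eq_one_or_mulVec_eq_zero (hd (j + 1) hj) (segProd d W₀ (j + 1) h) with
        ⟨R, hR⟩ | ⟨b, hb0, hb⟩
      · have h1 := hT W hW (segProd_eq_of_mul_eq (Nat.zero_le h) hWf) j hj (R * B)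
        rwa [segProd_eq_of_mul_eq hj hWf, ← Matrix.mul_assoc, hR, Matrix.one_mul] at h1
      · rcases ih with rfl | ih
        · rw [segProd_self, Matrix.one_mulVec] at hb
          exact absurd hb hb0
        rw [eq_sum_vecMulVec_mul_vecMulVec_right hb0 B, Matrix.sum_mul, map_sum]
        refine Finset.sum_eq_zero fun c _ => ?_
        generalize vecMulVec (Pi.single c 1) ((b ⬝ᵥ b)⁻¹ • b) = D
        generalize B c = w
        obtain ⟨t, ht0, ht⟩ := exists_ne_zero_forall_frob_update_lt hW hj (vecMulVec b w)
        have h1 := ih _ ht (fun i hi => by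
          rcases eq_or_ne i j with rfl | hij
          · rw [Function.update_self, Matrix.mul_add, Matrix.mul_smul, mul_vecMulVec, hb,
              zero_vecMulVec, smul_zero, add_zero, hWf i hi]
          · rw [Function.update_of_ne hij, hWf i hi]) D
        have h2 := ih W hW hWf D
        rw [segProd_succ _ (Nat.zero_le j), segProd_update_of_le W (Nat.zero_le j) le_rfl,
          Function.update_self, Matrix.add_mul, Matrix.mul_add, ← segProd_succ W (Nat.zero_le j),
          map_add, h2, zero_add, Matrix.smul_mul, Matrix.mul_smul, map_smul, smul_eq_mul] at h1
        rw [Matrix.mul_assoc]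
        exact (mul_eq_zero.mp h1).resolve_left ht0
  have h1 := ((key 0 (Nat.zero_le h)).resolve_left (by omega)) W₀
    (by simpa [frob_zero] using fun _ _ => hε) (fun _ _ => rfl) C
  rwa [segProd_self, Matrix.mul_one] at h1

/-- At a point of maximal rank the tangent directions span everything. -/
theorem eq_zero_of_rank_eq (hh : 1 ≤ h) (hrank : (segProd d W₀ 0 h).rank = min (d h) (d 0))
    (hT : ∀ i < h, ∀ A : Matrix (Fin (d (i + 1))) (Fin (d i)) ℝ,
      T (segProd d W₀ (i + 1) h * A * segProd d W₀ 0 i) = 0)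
    (C : Matrix (Fin (d h)) (Fin (d 0)) ℝ) : T C = 0 := by
  rcases le_total (d 0) (d h) with hle | hle
  · obtain ⟨p, rfl⟩ : ∃ p, h = p + 1 := ⟨h - 1, by omega⟩
    rw [min_eq_right hle, segProd_succ W₀ (Nat.zero_le p)] at hrank
    have hp : (segProd d W₀ 0 p).rank = d 0 :=
      le_antisymm (rank_le_width _) (hrank.symm.le.trans (rank_mul_le_right _ _))
    obtain ⟨L, hL⟩ := exists_mul_eq_one_of_rank_eq' hp
    simpa [segProd_self, Matrix.mul_assoc, hL] using hT p p.lt_succ_self (C * L)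
  · rw [min_eq_left hle, segProd_eq_mul W₀ (by omega)] at hrank
    have hp : (segProd d W₀ (0 + 1) h).rank = d h :=
      le_antisymm (rank_le_height _) (hrank.symm.le.trans (rank_mul_le_left _ _))
    obtain ⟨R, hR⟩ := exists_mul_eq_one_of_rank_eq hp
    have h1 := hT 0 (by omega) (R * C)
    rwa [segProd_self, Matrix.mul_one, ← Matrix.mul_assoc, hR, Matrix.one_mul] at h1

end Fiber

theorem hasDerivAt_comp_add_smul {E : Type*} [NormedAddCommGroup E] [NormedSpace ℝ E] {f : E → ℝ}
    (hf : Differentiable ℝ f) (x v : E) :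
    HasDerivAt (fun t : ℝ => f (x + t • v)) (fderiv ℝ f x v) 0 :=
  (hf x).hasFDerivAt.hasLineDerivAt v

/-- A differentiable convex function is at least its value at `x` in every direction along which its
derivative at `x` vanishes. -/
theorem ConvexOn.le_add_of_fderiv_eq_zero {E : Type*} [NormedAddCommGroup E] [NormedSpace ℝ E]
    {f : E → ℝ} (hconv : ConvexOn ℝ Set.univ f) (hf : Differentiable ℝ f) {x v : E}
    (hv : fderiv ℝ f x v = 0) : f x ≤ f (x + v) := by
  have hg : ConvexOn ℝ Set.univ fun t : ℝ => f (x + t • v) := by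
    have := hconv.comp_affineMap (AffineMap.lineMap x (x + v) : ℝ →ᵃ[ℝ] E)
    simpa [Function.comp_def, AffineMap.lineMap_apply, add_comm] using this
  have h1 := hg.le_slope_of_hasDerivAt (Set.mem_univ 0) (Set.mem_univ 1) one_pos
    (hasDerivAt_comp_add_smul hf x v)
  simpa [slope_def_field, hv] using h1

/-- Let `ℓ` be convex and differentiable, and suppose
`min_{0 ≤ i ≤ h} dᵢ = min(d_h, d_0)`.  Then for `f(W) = ℓ(W_h ⋯ W_1 X)`:
(a) every non-degenerate critical point of `f` is a global minimum;
(b) every degenerate critical point of `f` is either a global minimum or not a local minimum.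
A critical point is a point where the derivative of `f` vanishes in every direction. -/
theorem statement_13 {n : ℕ} (h : ℕ) (hh : 1 ≤ h) (d : ℕ → ℕ)
    (ℓ : Matrix (Fin (d h)) (Fin n) ℝ → ℝ)
    (hconv : ConvexOn ℝ Set.univ ℓ) (hdiff : Differentiable ℝ ℓ)
    (X : Matrix (Fin (d 0)) (Fin n) ℝ)
    (hdim : (Finset.range (h + 1)).inf' (Finset.nonempty_range_iff.mpr (Nat.succ_ne_zero h)) d =
      min (d h) (d 0))
    (W₀ : (i : ℕ) → Matrix (Fin (d (i + 1))) (Fin (d i)) ℝ)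
    (hcrit : ∀ A : (i : ℕ) → Matrix (Fin (d (i + 1))) (Fin (d i)) ℝ,
      HasDerivAt (fun t : ℝ => ℓ (chainProd d (fun i => W₀ i + t • A i) h * X)) 0 0) :
    ((chainProd d W₀ h).rank =
        (Finset.range (h + 1)).inf' (Finset.nonempty_range_iff.mpr (Nat.succ_ne_zero h)) d →
      ∀ W : (i : ℕ) → Matrix (Fin (d (i + 1))) (Fin (d i)) ℝ,
        ℓ (chainProd d W₀ h * X) ≤ ℓ (chainProd d W h * X)) ∧
    ((chainProd d W₀ h).rank <
        (Finset.range (h + 1)).inf' (Finset.nonempty_range_iff.mpr (Nat.succ_ne_zero h)) d →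
      (∀ W : (i : ℕ) → Matrix (Fin (d (i + 1))) (Fin (d i)) ℝ,
        ℓ (chainProd d W₀ h * X) ≤ ℓ (chainProd d W h * X)) ∨
      ¬ (∃ ε > 0, ∀ W : (i : ℕ) → Matrix (Fin (d (i + 1))) (Fin (d i)) ℝ,
        (∀ i < h, frob (W i - W₀ i) < ε) →
          ℓ (chainProd d W₀ h * X) ≤ ℓ (chainProd d W h * X))) := by
  have hchain := chainProd_eq_segProd (d := d)
  simp only [hchain] at hcrit ⊢
  set M := segProd d W₀ 0 h with hM
  let T : Matrix (Fin (d h)) (Fin (d 0)) ℝ →ₗ[ℝ] ℝ :=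
    { toFun := fun C => fderiv ℝ ℓ (M * X) (C * X)
      map_add' := fun A B => by rw [Matrix.add_mul, map_add]
      map_smul' := fun c A => by rw [Matrix.smul_mul, map_smul, RingHom.id_apply] }
  have hglobal : (∀ C, T C = 0) → ∀ W : (i : ℕ) → Matrix (Fin (d (i + 1))) (Fin (d i)) ℝ,
      ℓ (M * X) ≤ ℓ (segProd d W 0 h * X) := by
    intro hT W
    have h1 := hconv.le_add_of_fderiv_eq_zero hdiff (hT (segProd d W 0 h - M))
    rwa [Matrix.sub_mul, add_sub_cancel] at h1
  have hderiv : ∀ W : (i : ℕ) → Matrix (Fin (d (i + 1))) (Fin (d i)) ℝ, segProd d W 0 h = M →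
      ∀ i < h, ∀ A : Matrix (Fin (d (i + 1))) (Fin (d i)) ℝ, HasDerivAt
        (fun t : ℝ => ℓ (segProd d (Function.update W i (W i + t • A)) 0 h * X))
        (T (segProd d W (i + 1) h * A * segProd d W 0 i)) 0 := by
    intro W hW i hi A
    have h1 := hasDerivAt_comp_add_smul hdiff (M * X)
      (segProd d W (i + 1) h * A * segProd d W 0 i * X)
    simp only [segProd_update_add_smul W hi, hW, Matrix.add_mul, Matrix.smul_mul]
    exact h1
  refine ⟨fun hrank => hglobal (eq_zero_of_rank_eq hh (hrank.trans hdim) fun i hi A => ?_),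
    fun _ => or_iff_not_imp_right.mpr fun hloc => hglobal ?_⟩
  · refine (hderiv W₀ hM.symm i hi A).unique ?_
    have hupd : ∀ t : ℝ, Function.update W₀ i (W₀ i + t • A) =
        fun j => W₀ j + t •
          Function.update (0 : ∀ j, Matrix (Fin (d (j + 1))) (Fin (d j)) ℝ) i A j := by
      intro t
      funext j
      rcases eq_or_ne j i with rfl | hji
      · simp
      · simp [hji]
    simpa only [hupd] using hcrit (Function.update 0 i A)
  · obtain ⟨ε, hε, hmin⟩ := not_not.mp hloc
    have hT : ∀ W : (i : ℕ) → Matrix (Fin (d (i + 1))) (Fin (d i)) ℝ,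
        (∀ i < h, frob (W i - W₀ i) < ε) → segProd d W 0 h = M →
        ∀ i < h, ∀ A : Matrix (Fin (d (i + 1))) (Fin (d i)) ℝ,
          T (segProd d W (i + 1) h * A * segProd d W 0 i) = 0 := by
      intro W hW hWM i hi A
      refine IsLocalMin.hasDerivAt_eq_zero ?_ (hderiv W hWM i hi A)
      filter_upwards [eventually_forall_frob_update_lt hW hi A] with t ht
      simpa [hWM] using hmin _ ht
    have hd : ∀ j ≤ h, min (d h) (d 0) ≤ d j := fun j hj =>
      hdim ▸ Finset.inf'_le d (Finset.mem_range_succ_iff.mpr hj)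
    rcases le_total (d 0) (d h) with hle | hle
    · exact eq_zero_of_forall_fiber_of_input_le hh hε (by rwa [min_eq_right hle] at hd) hT
    · exact eq_zero_of_forall_fiber_of_output_le hh hε (by rwa [min_eq_left hle] at hd) hT
end

section
/- Let V ∈ ℝ^{m×n} be a matrix with rank(V) = r < m. Then there exist an index set B = {i_1, …, i_r} ⊆ {1, …, m} of size r and a matrix A ∈ ℝ^{(m−r)×r} with max over all entries of |A_{ij}| ≤ 2^{m−r−1}, such that V_{B^c} = A·V_B, where V_B ∈ ℝ^{r×n} is the submatrix of V formed by the rows indexed by B and V_{B^c} ∈ ℝ^{(m−r)×n} is the submatrix formed by the remaining rows. -/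
open Matrix

/-- A finite spanning family of a real vector space contains a basis with respect to which all
members of the family have coordinates in `[-1, 1]`. -/
theorem exists_injective_forall_eq_sum_abs_le_one {ι W : Type*} [Finite ι] [AddCommGroup W]
    [Module ℝ W] (v : ι → W) (hv : Submodule.span ℝ (Set.range v) = ⊤) :
    ∃ f : Fin (Module.finrank ℝ W) → ι, Function.Injective f ∧
      ∀ i, ∃ c : Fin (Module.finrank ℝ W) → ℝ,
        (∀ k, |c k| ≤ 1) ∧ v i = ∑ k, c k • v (f k) := by
  classical
  have : Module.Finite ℝ W := ⟨⟨(Set.finite_range v).toFinset, by simpa using hv⟩⟩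
  let e := Module.finBasis ℝ W
  obtain ⟨κ, a, ha, hspan, hli⟩ := exists_linearIndependent' ℝ v
  have : Finite κ := Finite.of_injective a ha
  have : Fintype κ := Fintype.ofFinite κ
  let b := Module.Basis.mk hli (hspan.trans hv).ge
  let σ : Fin (Module.finrank ℝ W) ≃ κ := e.indexEquiv b
  have hσ : IsUnit (e.det (v ∘ a ∘ σ)) := by
    have hb : v ∘ a ∘ σ = b.reindex σ.symm := by
      funext k
      simp [b]
    exact hb ▸ e.isUnit_det (b.reindex σ.symm)
  have : Nonempty (Fin (Module.finrank ℝ W) → ι) := ⟨a ∘ σ⟩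
  obtain ⟨f, hf⟩ := Finite.exists_max fun f : Fin (Module.finrank ℝ W) → ι => |e.det (v ∘ f)|
  have hpos : 0 < |e.det (v ∘ f)| := (abs_pos.2 hσ.ne_zero).trans_le (hf (a ∘ σ))
  obtain ⟨hfli, hfspan⟩ := (e.is_basis_iff_det).2 (isUnit_iff_ne_zero.2 (abs_pos.1 hpos))
  refine ⟨f, hfli.injective.of_comp, fun i => ?_⟩
  let c := Module.Basis.mk hfli hfspan.ge
  refine ⟨fun k => c.repr (v i) k, fun k => ?_, ?_⟩
  · have h : e.det (v ∘ f) * c.repr (v i) k = e.det (v ∘ Function.update f k i) := by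
      have := congrArg (fun l : W →ₗ[ℝ] ℝ => l (v i))
        (e.det_smul_mk_coord_eq_det_update hfli hfspan.ge k)
      simpa [c, Function.comp_update] using this
    have hmax := hf (Function.update f k i)
    rw [← h, abs_mul] at hmax
    exact le_of_mul_le_mul_left (by simpa using hmax) hpos
  · simpa [c] using (c.sum_repr (v i)).symm

/-- If `V ∈ ℝ^{m×n}` has `rank V = r < m`, then there is an index set `B` of
`r` rows and coefficients `A` bounded entrywise by `2^(m−r−1)` expressing every row outside `B`
as a linear combination of the rows in `B` (i.e. `V_{Bᶜ} = A · V_B`). -/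
theorem statement_14 {m n : ℕ} (V : Matrix (Fin m) (Fin n) ℝ) (r : ℕ)
    (hrank : V.rank = r) (hrm : r < m) :
    ∃ B : Finset (Fin m), B.card = r ∧
      ∃ A : Fin m → Fin m → ℝ,
        (∀ i ∉ B, ∀ j ∈ B, |A i j| ≤ 2 ^ (m - r - 1)) ∧
        (∀ i ∉ B, V i = ∑ j ∈ B, A i j • V j) := by
  let v : Fin m → Submodule.span ℝ (Set.range V.row) :=
    fun i => ⟨V.row i, Submodule.subset_span ⟨i, rfl⟩⟩
  obtain ⟨f, hf, hc⟩ := exists_injective_forall_eq_sum_abs_le_one v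
    (Submodule.span_range_subtype_eq_top_iff _ _ |>.2 rfl)
  choose c hc hvc using hc
  refine ⟨Finset.univ.map ⟨f, hf⟩, ?_, fun i => Function.extend f (c i) 0, ?_, ?_⟩
  · simp [← hrank, V.rank_eq_finrank_span_row]
  · intro i _ j hj
    obtain ⟨k, -, rfl⟩ := Finset.mem_map.1 hj
    simpa [hf.extend_apply] using (hc i k).trans (one_le_pow₀ one_le_two)
  · intro i _
    rw [Finset.sum_map]
    simp only [Function.Embedding.coeFn_mk, hf.extend_apply]
    have h := congrArg Subtype.val (hvc i)
    simp only [Submodule.coe_sum, Submodule.coe_smul] at h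
    exact h
end

section
/- Let W1 ∈ ℝ^{m×k} and W2 ∈ ℝ^{k×n}, and let W1·W2 = U·Σ·Vᵀ be a singular value decomposition of the product, with U ∈ ℝ^{m×m} and V ∈ ℝ^{n×n} orthogonal and Σ ∈ ℝ^{m×n}. Then the matrix multiplication mapping M(A, B) = A·B is locally open at (W1, W2) relative to its range R_M if and only if M is locally open at (Uᵀ·W1, W2·V) relative to R_M. -/
open Matrix

/-- Local openness of the matrix multiplication mapping `M(W1, W2) = W1 * W2` at `(W1, W2)`
relative to its range `R_M = {Z : rank Z ≤ min (m, n, k)}`, with respect to the Frobenius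
norm (and the corresponding product metric on pairs). -/
def MulLocOpenAt {m k n : ℕ} (W1 : Matrix (Fin m) (Fin k) ℝ)
    (W2 : Matrix (Fin k) (Fin n) ℝ) : Prop :=
  ∀ ε > 0, ∃ δ > 0, ∀ Z : Matrix (Fin m) (Fin n) ℝ,
    Z.rank ≤ min m (min n k) → frob (Z - W1 * W2) < δ →
      ∃ (V1 : Matrix (Fin m) (Fin k) ℝ) (V2 : Matrix (Fin k) (Fin n) ℝ),
        frob (V1 - W1) < ε ∧ frob (V2 - W2) < ε ∧ V1 * V2 = Z

theorem frob_eq_sqrt_trace {m n : ℕ} (A : Matrix (Fin m) (Fin n) ℝ) :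
    frob A = Real.sqrt (Aᵀ * A).trace := by
  rw [frob, Finset.sum_comm]
  simp [Matrix.trace, Matrix.mul_apply, sq]

theorem frob_transpose {m n : ℕ} (A : Matrix (Fin m) (Fin n) ℝ) : frob Aᵀ = frob A := by
  rw [frob, frob, Finset.sum_comm]
  rfl

theorem frob_mul_of_transpose_mul_self {l m n : ℕ} {P : Matrix (Fin l) (Fin m) ℝ}
    (hP : Pᵀ * P = 1) (A : Matrix (Fin m) (Fin n) ℝ) : frob (P * A) = frob A := by
  rw [frob_eq_sqrt_trace, frob_eq_sqrt_trace, transpose_mul, Matrix.mul_assoc,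
    ← Matrix.mul_assoc Pᵀ, hP, Matrix.one_mul]

theorem frob_mul_of_mul_transpose_self {m n l : ℕ} {Q : Matrix (Fin n) (Fin l) ℝ}
    (hQ : Q * Qᵀ = 1) (A : Matrix (Fin m) (Fin n) ℝ) : frob (A * Q) = frob A := by
  rw [← frob_transpose, transpose_mul, frob_mul_of_transpose_mul_self (by simpa using hQ),
    frob_transpose]

/-- Local openness of matrix multiplication is preserved when the outer factors are multiplied by
orthogonal matrices. -/
theorem MulLocOpenAt.orthogonal_mul {m k n : ℕ}
    {W1 : Matrix (Fin m) (Fin k) ℝ} {W2 : Matrix (Fin k) (Fin n) ℝ} (h : MulLocOpenAt W1 W2)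
    {P : Matrix (Fin m) (Fin m) ℝ} {Q : Matrix (Fin n) (Fin n) ℝ}
    (hP : Pᵀ * P = 1) (hQ : Q * Qᵀ = 1) : MulLocOpenAt (P * W1) (W2 * Q) := by
  have hP' : P * Pᵀ = 1 := mul_eq_one_comm.mp hP
  have hQ' : Qᵀ * Q = 1 := mul_eq_one_comm.mp hQ
  intro ε hε
  obtain ⟨δ, hδ, hopen⟩ := h ε hε
  refine ⟨δ, hδ, fun Z hZ hZδ => ?_⟩
  have hrank : (Pᵀ * Z * Qᵀ).rank ≤ min m (min n k) :=
    ((rank_mul_le_left _ _).trans (rank_mul_le_right _ _)).trans hZ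
  have hdist : Z - P * W1 * (W2 * Q) = P * (Pᵀ * Z * Qᵀ - W1 * W2) * Q := by
    have hZ' : P * (Pᵀ * Z * Qᵀ) * Q = Z := by
      calc P * (Pᵀ * Z * Qᵀ) * Q = (P * Pᵀ) * Z * (Qᵀ * Q) := by simp only [Matrix.mul_assoc]
        _ = Z := by rw [hP', hQ', Matrix.one_mul, Matrix.mul_one]
    rw [Matrix.mul_sub, Matrix.sub_mul, hZ']
    simp only [Matrix.mul_assoc]
  rw [hdist, frob_mul_of_mul_transpose_self hQ, frob_mul_of_transpose_mul_self hP] at hZδ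
  obtain ⟨V1, V2, h1, h2, h12⟩ := hopen _ hrank hZδ
  refine ⟨P * V1, V2 * Q, ?_, ?_, ?_⟩
  · rwa [← Matrix.mul_sub, frob_mul_of_transpose_mul_self hP]
  · rwa [← Matrix.sub_mul, frob_mul_of_mul_transpose_self hQ]
  · calc P * V1 * (V2 * Q) = P * (V1 * V2) * Q := by simp only [Matrix.mul_assoc]
      _ = (P * Pᵀ) * Z * (Qᵀ * Q) := by rw [h12]; simp only [Matrix.mul_assoc]
      _ = Z := by rw [hP', hQ', Matrix.one_mul, Matrix.mul_one]

/-- If `W1·W2 = U·S·Vᵀ` is a singular value decomposition (with `U`, `V`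
orthogonal and `S` rectangular diagonal with nonnegative entries), then matrix multiplication is
locally open at `(W1, W2)` relative to its range iff it is locally open at `(Uᵀ·W1, W2·V)`
relative to its range. -/
theorem statement_15 {m k n : ℕ}
    (W1 : Matrix (Fin m) (Fin k) ℝ) (W2 : Matrix (Fin k) (Fin n) ℝ)
    (U : Matrix (Fin m) (Fin m) ℝ) (V : Matrix (Fin n) (Fin n) ℝ)
    (S : Matrix (Fin m) (Fin n) ℝ)
    (hU : Uᵀ * U = 1) (hV : Vᵀ * V = 1)
    (hSdiag : ∀ (i : Fin m) (j : Fin n), (i : ℕ) ≠ (j : ℕ) → S i j = 0)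
    (hSpos : ∀ (i : Fin m) (j : Fin n), 0 ≤ S i j)
    (hSVD : W1 * W2 = U * S * Vᵀ) :
    MulLocOpenAt W1 W2 ↔ MulLocOpenAt (Uᵀ * W1) (W2 * V) := by
  have hU' : U * Uᵀ = 1 := mul_eq_one_comm.mp hU
  have hV' : V * Vᵀ = 1 := mul_eq_one_comm.mp hV
  refine ⟨fun h => h.orthogonal_mul (by simpa using hU') hV', fun h => ?_⟩
  have h' := h.orthogonal_mul hU (Q := Vᵀ) (by simpa using hV)
  rwa [← Matrix.mul_assoc, hU', Matrix.one_mul, Matrix.mul_assoc, hV', Matrix.mul_one] at h'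
end

section
/- Let X ∈ ℝ^{d0×n}, Y ∈ ℝ^{dh×n}, and consider the objective f(W_h, …, W_1) = (1/2)·‖W_h···W_1·X − Y‖² with Wᵢ ∈ ℝ^{dᵢ×d_{i−1}} and h ≥ 3. Let W̄ = (W̄_h, …, W̄_1) be a degenerate critical point of f (the gradient of f vanishes at W̄ and rank(W̄_h···W̄_1) < min over 0 ≤ i ≤ h of dᵢ) such that for every i with 2 ≤ i ≤ h − 1 both the null space of W̄ᵢ and the null space of W̄ᵢᵀ are nontrivial. If, in addition, the null space of W̄_h is nontrivial or the null space of W̄_1ᵀ is nontrivial, then W̄ is either a global minimum of f or not a local minimum of f. -/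
open Matrix

/-- Perturbation of the layers `W i` by the rank-one matrices `s i • w (i + 1) (w i)ᵀ`. -/
noncomputable def rankOnePerturb {d : ℕ → ℕ}
    (W : (i : ℕ) → Matrix (Fin (d (i + 1))) (Fin (d i)) ℝ)
    (w : (i : ℕ) → Fin (d i) → ℝ) (s : ℕ → ℝ) (i : ℕ) :
    Matrix (Fin (d (i + 1))) (Fin (d i)) ℝ :=
  W i + s i • vecMulVec (w (i + 1)) (w i)

lemma frob_sq {m n : ℕ} (A : Matrix (Fin m) (Fin n) ℝ) : frob A ^ 2 = (A * Aᵀ).trace := by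
  have h : 0 ≤ ∑ i, ∑ j, A i j ^ 2 := by positivity
  rw [frob, Real.sq_sqrt h]
  simp [Matrix.trace, Matrix.mul_apply, sq]

lemma frob_nonneg {m n : ℕ} (A : Matrix (Fin m) (Fin n) ℝ) : 0 ≤ frob A :=
  Real.sqrt_nonneg _

lemma frob_smul {m n : ℕ} (c : ℝ) (A : Matrix (Fin m) (Fin n) ℝ) :
    frob (c • A) = |c| * frob A := by
  have h : frob (c • A) ^ 2 = (|c| * frob A) ^ 2 := by
    rw [mul_pow, frob_sq, frob_sq, sq_abs]
    simp only [transpose_smul, smul_mul, Matrix.mul_smul, trace_smul, smul_eq_mul]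
    ring
  exact (pow_left_inj₀ (frob_nonneg _) (mul_nonneg (abs_nonneg _) (frob_nonneg _))
    two_ne_zero).1 h

lemma frob_add_mul_sub_sq {m k n : ℕ} (P E : Matrix (Fin m) (Fin k) ℝ)
    (X : Matrix (Fin k) (Fin n) ℝ) (Y : Matrix (Fin m) (Fin n) ℝ) :
    frob ((P + E) * X - Y) ^ 2 = frob (P * X - Y) ^ 2 +
      2 * ((P * X - Y) * Xᵀ * Eᵀ).trace + frob (E * X) ^ 2 := by
  have h1 : (P + E) * X - Y = (P * X - Y) + E * X := by
    rw [Matrix.add_mul]; abel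
  rw [h1]
  generalize P * X - Y = D
  have h2 : (E * X * Dᵀ).trace = (D * Xᵀ * Eᵀ).trace := by
    rw [← trace_transpose]
    simp [Matrix.mul_assoc]
  simp only [frob_sq, transpose_add, Matrix.add_mul, Matrix.mul_add, trace_add, h2]
  simp only [transpose_mul, Matrix.mul_assoc]
  ring

lemma frob_le_of_gradient_eq_zero {m k n : ℕ} {P : Matrix (Fin m) (Fin k) ℝ}
    {X : Matrix (Fin k) (Fin n) ℝ} {Y : Matrix (Fin m) (Fin n) ℝ}
    (hG : (P * X - Y) * Xᵀ = 0) (Q : Matrix (Fin m) (Fin k) ℝ) :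
    frob (P * X - Y) ^ 2 ≤ frob (Q * X - Y) ^ 2 := by
  have h := frob_add_mul_sub_sq P (Q - P) X Y
  rw [hG, Matrix.zero_mul, trace_zero, add_sub_cancel] at h
  nlinarith [sq_nonneg (frob ((Q - P) * X))]

lemma eq_zero_of_forall_quadratic_nonneg {b c τ : ℝ} (hc : 0 ≤ c) (hτ : 0 < τ)
    (h : ∀ t : ℝ, |t| < τ → 0 ≤ 2 * (t * b) + t ^ 2 * c) : b = 0 := by
  by_contra hb
  have hb' : 0 < |b| := abs_pos.2 hb
  obtain ⟨r, hr0, hr⟩ : ∃ r : ℝ, 0 < r ∧ r * (|b| + c) < min τ 1 * |b| := by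
    refine ⟨min τ 1 * |b| / (2 * (|b| + c)), by positivity, ?_⟩
    have : 0 < min τ 1 * |b| := by positivity
    have h2 : 0 < |b| + c := by positivity
    field_simp
    linarith
  have hrc : 0 ≤ r * c := by positivity
  have h1 : r < τ := by
    have := min_le_left τ 1
    by_contra hle
    nlinarith
  have h2 : r * c < |b| := by
    have := min_le_right τ 1
    nlinarith
  rcases lt_or_gt_of_ne hb with hneg | hpos
  · have := h r (by rwa [abs_of_pos hr0])
    rw [abs_of_neg hneg] at h2
    nlinarith
  · have := h (-r) (by rwa [abs_neg, abs_of_pos hr0])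
    rw [abs_of_pos hpos] at h2
    nlinarith

lemma dotProduct_gradient_eq_zero {m k n : ℕ} {P : Matrix (Fin m) (Fin k) ℝ}
    {X : Matrix (Fin k) (Fin n) ℝ} {Y : Matrix (Fin m) (Fin n) ℝ}
    {q : Fin m → ℝ} {x : Fin k → ℝ} {τ : ℝ} (hτ : 0 < τ)
    (h : ∀ t : ℝ, |t| < τ →
      frob (P * X - Y) ^ 2 ≤ frob ((P + t • vecMulVec q x) * X - Y) ^ 2) :
    q ⬝ᵥ (((P * X - Y) * Xᵀ) *ᵥ x) = 0 := by
  refine eq_zero_of_forall_quadratic_nonneg (sq_nonneg (frob (vecMulVec q x * X))) hτ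
    fun t ht => ?_
  have h1 := h t ht
  rw [frob_add_mul_sub_sq, smul_mul, frob_smul, mul_pow, sq_abs, transpose_smul,
    Matrix.mul_smul, trace_smul, transpose_vecMulVec, mul_vecMulVec, trace_vecMulVec,
    dotProduct_comm, smul_eq_mul] at h1
  linarith

lemma exists_small_add_mul_ne_zero {a b C ε : ℝ} (hC : 0 ≤ C) (hε : 0 < ε) :
    ∃ s : ℝ, |s| * C < ε ∧ (b ≠ 0 → a + s * b ≠ 0) := by
  have key : ∀ k : ℝ, 1 ≤ k → |ε / (k * (C + 1))| * C < ε := fun k hk => by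
    rw [abs_of_pos (by positivity), div_mul_eq_mul_div, div_lt_iff₀ (by positivity)]
    nlinarith [mul_le_mul_of_nonneg_right hk (by positivity : 0 ≤ C + 1)]
  by_cases h : a + ε / (1 * (C + 1)) * b = 0
  · refine ⟨ε / (2 * (C + 1)), key 2 (by norm_num), fun hb h' => hb ?_⟩
    have h2 : ε / (1 * (C + 1)) * b - ε / (2 * (C + 1)) * b = 0 := by linarith
    have h3 : ε / (2 * (C + 1)) * b = 0 := by
      rw [← h2]; field_simp; ring
    exact (mul_eq_zero.1 h3).resolve_left (by positivity)
  · exact ⟨_, key 1 le_rfl, fun _ => h⟩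

/-- Arbitrarily small rank-one perturbations along nonzero vectors `w i` propagate `w 0` to a
vector that is not orthogonal to `w N`. -/
lemma exists_small_rankOnePerturb {d : ℕ → ℕ}
    (W : (i : ℕ) → Matrix (Fin (d (i + 1))) (Fin (d i)) ℝ)
    (w : (i : ℕ) → Fin (d i) → ℝ) {ε : ℝ} (hε : 0 < ε) :
    ∃ (s : ℕ → ℝ) (a : (i : ℕ) → Fin (d i) → ℝ), a 0 = w 0 ∧
      (∀ i, a (i + 1) = rankOnePerturb W w s i *ᵥ a i) ∧
      (∀ i, |s i| * frob (vecMulVec (w (i + 1)) (w i)) < ε) ∧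
      ∀ N, (∀ i ≤ N, w i ≠ 0) → w N ⬝ᵥ a N ≠ 0 := by
  have step : ∀ (i : ℕ) (a : Fin (d i) → ℝ), ∃ s : ℝ,
      |s| * frob (vecMulVec (w (i + 1)) (w i)) < ε ∧
      ((w (i + 1) ⬝ᵥ w (i + 1)) * (w i ⬝ᵥ a) ≠ 0 →
        w (i + 1) ⬝ᵥ (W i *ᵥ a) + s * ((w (i + 1) ⬝ᵥ w (i + 1)) * (w i ⬝ᵥ a)) ≠ 0) :=
    fun i a => exists_small_add_mul_ne_zero (frob_nonneg _) hε
  choose σ hσ hne using step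
  let a : (i : ℕ) → Fin (d i) → ℝ := fun i => Nat.rec (motive := fun i => Fin (d i) → ℝ) (w 0)
    (fun i b => (W i + σ i b • vecMulVec (w (i + 1)) (w i)) *ᵥ b) i
  have ha : ∀ i, a (i + 1) = rankOnePerturb W w (fun i => σ i (a i)) i *ᵥ a i := fun i => rfl
  refine ⟨fun i => σ i (a i), a, rfl, ha, fun i => hσ i _, fun N => ?_⟩
  induction N with
  | zero => exact fun h => dotProduct_self_eq_zero.not.2 (h 0 le_rfl)
  | succ N ih =>
    intro h
    have h1 := hne N (a N) (mul_ne_zero (dotProduct_self_eq_zero.not.2 (h (N + 1) le_rfl))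
      (ih fun i hi => h i (by omega)))
    rw [ha, rankOnePerturb, add_mulVec, dotProduct_add, smul_mulVec, dotProduct_smul,
      vecMulVec_mulVec]
    simpa [dotProduct_smul, mul_comm] using h1

lemma frob_rankOnePerturb_sub {d : ℕ → ℕ}
    (W : (i : ℕ) → Matrix (Fin (d (i + 1))) (Fin (d i)) ℝ)
    (w : (i : ℕ) → Fin (d i) → ℝ) (s : ℕ → ℝ) (i : ℕ) :
    frob (rankOnePerturb W w s i - W i) = |s i| * frob (vecMulVec (w (i + 1)) (w i)) := by
  rw [rankOnePerturb, add_sub_cancel_left, frob_smul]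

lemma abs_mul_lt_of_abs_lt {t C ε : ℝ} (hC : 0 ≤ C) (ht : |t| < ε / (C + 1)) :
    |t| * C < ε := by
  rw [lt_div_iff₀ (by positivity)] at ht
  nlinarith [abs_nonneg t]

lemma exists_extension_of_ne_zero {d : ℕ → ℕ} {h : ℕ} (hh : h ≠ 0)
    {p : (i : ℕ) → (Fin (d i) → ℝ) → Prop} (hp : ∀ i, i ≠ 0 → i < h → ∃ x, p i x)
    (z : Fin (d 0) → ℝ) (u : Fin (d h) → ℝ) :
    ∃ w : (i : ℕ) → Fin (d i) → ℝ, w 0 = z ∧ w h = u ∧ ∀ i, i ≠ 0 → i < h → p i (w i) := by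
  have hp' : ∀ i, ∃ x : Fin (d i) → ℝ, i ≠ 0 → i < h → p i x := fun i => by
    by_cases hi : i ≠ 0 ∧ i < h
    · obtain ⟨x, hx⟩ := hp i hi.1 hi.2
      exact ⟨x, fun _ _ => hx⟩
    · exact ⟨0, fun h1 h2 => absurd ⟨h1, h2⟩ hi⟩
  choose f hf using hp'
  refine ⟨Function.update (Function.update f 0 z) h u, ?_, Function.update_self .., ?_⟩
  · rw [Function.update_of_ne hh.symm, Function.update_self]
  · intro i hi0 hih
    rw [Function.update_of_ne hih.ne, Function.update_of_ne hi0]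
    exact hf i hi0 hih

section Descent

variable {n m : ℕ} {d : ℕ → ℕ} {X : Matrix (Fin (d 0)) (Fin n) ℝ}
  {Y : Matrix (Fin (d (m + 1))) (Fin n) ℝ}
  {W : (i : ℕ) → Matrix (Fin (d (i + 1))) (Fin (d i)) ℝ} {ε : ℝ}

lemma chainProd_mulVec {V : (i : ℕ) → Matrix (Fin (d (i + 1))) (Fin (d i)) ℝ}
    {a : (i : ℕ) → Fin (d i) → ℝ} {N : ℕ} (ha : ∀ i < N, a (i + 1) = V i *ᵥ a i) :
    chainProd d V N *ᵥ a 0 = a N := by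
  induction N with
  | zero => simp [chainProd]
  | succ N ih =>
    rw [chainProd, ← mulVec_mulVec, ih fun i hi => ha i (by omega), ha N (by omega)]

/-- If each of the layers after the first has a nontrivial null space, the gradient of the
objective with respect to the product vanishes at a local minimum. -/
lemma gradient_eq_zero_of_null_right
    (hnull : ∀ i, i ≠ 0 → i < m + 1 → ∃ x : Fin (d i) → ℝ, x ≠ 0 ∧ W i *ᵥ x = 0)
    (hε : 0 < ε)
    (hmin : ∀ V : (i : ℕ) → Matrix (Fin (d (i + 1))) (Fin (d i)) ℝ,
      (∀ i < m + 1, frob (V i - W i) < ε) →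
        frob (chainProd d W (m + 1) * X - Y) ^ 2 ≤ frob (chainProd d V (m + 1) * X - Y) ^ 2) :
    (chainProd d W (m + 1) * X - Y) * Xᵀ = 0 := by
  by_contra hG
  set G := (chainProd d W (m + 1) * X - Y) * Xᵀ with hGdef
  obtain ⟨u, hu⟩ : ∃ u, Gᵀ *ᵥ u ≠ 0 := by
    by_contra! hcon
    refine hG (transpose_eq_zero.1 (ext_of_mulVec_single fun i => ?_))
    rw [hcon, zero_mulVec]
  obtain ⟨w, hw0, hwh, hw⟩ := exists_extension_of_ne_zero m.succ_ne_zero hnull (Gᵀ *ᵥ u) u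
  obtain ⟨s, a, ha0, ha, hs, hN⟩ := exists_small_rankOnePerturb W w hε
  have hprod : ∀ t : ℝ, chainProd d (rankOnePerturb W w (Function.update s m t)) m =
      chainProd d (rankOnePerturb W w s) m := by
    intro t
    have : ∀ N ≤ m, chainProd d (rankOnePerturb W w (Function.update s m t)) N =
        chainProd d (rankOnePerturb W w s) N := by
      intro N
      induction N with
      | zero => exact fun _ => rfl
      | succ N ih =>
        intro hle
        rw [chainProd, chainProd, ih (by omega), rankOnePerturb, rankOnePerturb,
          Function.update_of_ne (by omega)]
    exact this m le_rfl
  have hflat : ∀ N ≤ m, W N * chainProd d (rankOnePerturb W w s) N = chainProd d W (N + 1) := by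
    intro N
    induction N with
    | zero => exact fun _ => rfl
    | succ N ih =>
      intro hle
      rw [chainProd, ← Matrix.mul_assoc, rankOnePerturb, Matrix.mul_add, Matrix.mul_smul,
        mul_vecMulVec, (hw (N + 1) N.succ_ne_zero (by omega)).2, zero_vecMulVec, smul_zero,
        add_zero, Matrix.mul_assoc, ih (by omega)]
      rfl
  set M := chainProd d (rankOnePerturb W w s) m with hM
  have hτ : 0 < ε / (frob (vecMulVec (w (m + 1)) (w m)) + 1) := by
    have := frob_nonneg (vecMulVec (w (m + 1)) (w m))
    positivity
  have key := dotProduct_gradient_eq_zero (P := chainProd d W (m + 1)) (X := X) (Y := Y)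
    (q := u) (x := Mᵀ *ᵥ w m) hτ fun t ht => by
    have h1 := hmin (rankOnePerturb W w (Function.update s m t)) fun i hi => by
      rw [frob_rankOnePerturb_sub]
      by_cases him : i = m
      · subst him
        rw [Function.update_self]
        exact abs_mul_lt_of_abs_lt (frob_nonneg _) ht
      · rw [Function.update_of_ne him]
        exact hs i
    have h2 : chainProd d (rankOnePerturb W w (Function.update s m t)) (m + 1) =
        chainProd d W (m + 1) + t • vecMulVec u (Mᵀ *ᵥ w m) := by
      rw [chainProd, hprod, rankOnePerturb, Function.update_self, Matrix.add_mul,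
        hflat m le_rfl, smul_mul, vecMulVec_mul, mulVec_transpose, hwh]
    rwa [h2] at h1
  have hcm : M *ᵥ (Gᵀ *ᵥ u) = a m := by
    rw [← hw0, ← ha0]
    exact chainProd_mulVec fun i _ => ha i
  refine hN m (fun i hi => ?_) ?_
  · by_cases h0 : i = 0
    · subst h0
      rwa [hw0]
    · exact (hw i h0 (by omega)).1
  · rw [← hcm, ← key, ← hGdef, dotProduct_mulVec (w m), ← mulVec_transpose, dotProduct_comm,
      mulVec_transpose G, ← dotProduct_mulVec]

/-- If each of the layers before the last has a transpose with nontrivial null space, the gradient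
of the objective with respect to the product vanishes at a local minimum. -/
lemma gradient_eq_zero_of_null_left
    (hnull : ∀ i < m, ∃ y : Fin (d (i + 1)) → ℝ, y ≠ 0 ∧ (W i)ᵀ *ᵥ y = 0)
    (hε : 0 < ε)
    (hmin : ∀ V : (i : ℕ) → Matrix (Fin (d (i + 1))) (Fin (d i)) ℝ,
      (∀ i < m + 1, frob (V i - W i) < ε) →
        frob (chainProd d W (m + 1) * X - Y) ^ 2 ≤ frob (chainProd d V (m + 1) * X - Y) ^ 2) :
    (chainProd d W (m + 1) * X - Y) * Xᵀ = 0 := by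
  by_contra hG
  set G := (chainProd d W (m + 1) * X - Y) * Xᵀ with hGdef
  obtain ⟨u, hu⟩ : ∃ u, G *ᵥ u ≠ 0 := by
    by_contra! hcon
    refine hG (ext_of_mulVec_single fun i => ?_)
    rw [hcon, zero_mulVec]
  obtain ⟨w, hw0, hwh, hw⟩ := exists_extension_of_ne_zero m.succ_ne_zero
    (p := fun i x => x ≠ 0 ∧ x ᵥ* chainProd d W i = 0) (fun i h0 hi => by
      obtain ⟨j, rfl⟩ := Nat.exists_eq_succ_of_ne_zero h0
      obtain ⟨y, hy, hy'⟩ := hnull j (by omega)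
      refine ⟨y, hy, ?_⟩
      change y ᵥ* (W j * chainProd d W j) = 0
      rw [← vecMul_vecMul, ← mulVec_transpose (W j), hy',
        zero_vecMul]) u (G *ᵥ u)
  obtain ⟨s, a, ha0, ha, hs, hN⟩ := exists_small_rankOnePerturb (d := fun i => d (i + 1))
    (fun i => W (i + 1)) (fun i => w (i + 1)) hε
  have hτ : 0 < ε / (frob (vecMulVec (w 1) (w 0)) + 1) := by
    have := frob_nonneg (vecMulVec (w 1) (w 0))
    positivity
  have key := dotProduct_gradient_eq_zero (P := chainProd d W (m + 1)) (X := X) (Y := Y)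
    (q := a m) (x := u) hτ fun t ht => by
    let s' : ℕ → ℝ := fun i => Nat.casesOn i t s
    have h1 := hmin (rankOnePerturb W w s') fun i hi => by
      rw [frob_rankOnePerturb_sub]
      cases i with
      | zero => exact abs_mul_lt_of_abs_lt (frob_nonneg _) ht
      | succ i => exact hs i
    have h2 : ∀ N ≤ m, chainProd d (rankOnePerturb W w s') (N + 1) =
        chainProd d W (N + 1) + t • vecMulVec (a N) u := by
      intro N
      induction N with
      | zero =>
        intro _
        rw [ha0, ← hw0]
        simp [chainProd, rankOnePerturb, s']
      | succ N ih =>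
        intro hle
        have hz : vecMulVec (w (N + 1 + 1)) (w (N + 1)) * chainProd d W (N + 1) = 0 := by
          rw [vecMulVec_mul, (hw (N + 1) N.succ_ne_zero (by omega)).2]
          ext i j
          simp [vecMulVec_apply]
        have hW : rankOnePerturb W w s' (N + 1) * chainProd d W (N + 1) =
            chainProd d W (N + 1 + 1) := by
          rw [rankOnePerturb, Matrix.add_mul, smul_mul, hz, smul_zero, add_zero]
          rfl
        rw [chainProd, ih (by omega), Matrix.mul_add, hW, Matrix.mul_smul, mul_vecMulVec, ha N]
        rfl
    rwa [h2 m le_rfl] at h1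
  refine hN m (fun i hi => ?_) ?_
  · by_cases him : i = m
    · subst him
      rwa [hwh]
    · exact (hw (i + 1) i.succ_ne_zero (by omega)).1
  · rw [hwh, dotProduct_comm]
    exact key

end Descent

/-- Let `W₀ = (W_h, …, W_1)` be a degenerate critical point of
`f(W) = (1/2)·‖W_h ⋯ W_1 X − Y‖²` (here the paper's layer `W_i` is `W₀ (i-1)`), such that for
every `2 ≤ i ≤ h − 1` both `N(W_i)` and `N(W_iᵀ)` are nontrivial.  If moreover `N(W_h)` is
nontrivial or `N(W_1ᵀ)` is nontrivial, then `W₀` is either a global minimum of `f` or not a local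
minimum of `f`. -/
theorem statement_16 {n : ℕ} (h : ℕ) (hh : 3 ≤ h) (d : ℕ → ℕ)
    (X : Matrix (Fin (d 0)) (Fin n) ℝ) (Y : Matrix (Fin (d h)) (Fin n) ℝ)
    (W₀ : (i : ℕ) → Matrix (Fin (d (i + 1))) (Fin (d i)) ℝ)
    (hcrit : ∀ A : (i : ℕ) → Matrix (Fin (d (i + 1))) (Fin (d i)) ℝ,
      HasDerivAt (fun t : ℝ =>
        (1 / 2) * frob (chainProd d (fun i => W₀ i + t • A i) h * X - Y) ^ 2) 0 0)
    (hdeg : (chainProd d W₀ h).rank <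
      (Finset.range (h + 1)).inf' (Finset.nonempty_range_iff.mpr (Nat.succ_ne_zero h)) d)
    (hnull : ∀ i : ℕ, 1 ≤ i → i + 2 ≤ h →
      (∃ x : Fin (d i) → ℝ, x ≠ 0 ∧ (W₀ i).mulVec x = 0) ∧
      (∃ y : Fin (d (i + 1)) → ℝ, y ≠ 0 ∧ (W₀ i)ᵀ.mulVec y = 0))
    (hend : (∃ x : Fin (d (h - 1)) → ℝ, x ≠ 0 ∧ (W₀ (h - 1)).mulVec x = 0) ∨
      (∃ y : Fin (d 1) → ℝ, y ≠ 0 ∧ (W₀ 0)ᵀ.mulVec y = 0)) :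
    (∀ W : (i : ℕ) → Matrix (Fin (d (i + 1))) (Fin (d i)) ℝ,
      (1 / 2) * frob (chainProd d W₀ h * X - Y) ^ 2 ≤
        (1 / 2) * frob (chainProd d W h * X - Y) ^ 2) ∨
    ¬ (∃ ε > 0, ∀ W : (i : ℕ) → Matrix (Fin (d (i + 1))) (Fin (d i)) ℝ,
      (∀ i < h, frob (W i - W₀ i) < ε) →
        (1 / 2) * frob (chainProd d W₀ h * X - Y) ^ 2 ≤
          (1 / 2) * frob (chainProd d W h * X - Y) ^ 2) := by
  obtain ⟨m, rfl⟩ : ∃ m, h = m + 1 := ⟨h - 1, by omega⟩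
  by_cases hG : (chainProd d W₀ (m + 1) * X - Y) * Xᵀ = 0
  · refine Or.inl fun W => ?_
    have := frob_le_of_gradient_eq_zero hG (chainProd d W (m + 1))
    linarith
  · refine Or.inr fun ⟨ε, hε, hmin⟩ => hG ?_
    have hmin' : ∀ V : (i : ℕ) → Matrix (Fin (d (i + 1))) (Fin (d i)) ℝ,
        (∀ i < m + 1, frob (V i - W₀ i) < ε) →
          frob (chainProd d W₀ (m + 1) * X - Y) ^ 2 ≤
            frob (chainProd d V (m + 1) * X - Y) ^ 2 := fun V hV => by
      linarith [hmin V hV]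
    rcases hend with hend | hend
    · refine gradient_eq_zero_of_null_right (fun i h0 hi => ?_) hε hmin'
      by_cases him : i = m
      · subst him
        exact hend
      · exact (hnull i (by omega) (by omega)).1
    · refine gradient_eq_zero_of_null_left (fun i hi => ?_) hε hmin'
      by_cases h0 : i = 0
      · subst h0
        exact hend
      · exact (hnull i (by omega) (by omega)).2
end

section
/- Let Σ ∈ ℝ^{n×n} be a diagonal positive definite matrix. Then there exists δ₀ > 0 such that for every δ with 0 < δ < δ₀ and every symmetric matrix R ∈ ℝ^{n×n} with ‖R‖_∞ ≤ δ, there exists an upper-triangular matrix P ∈ ℝ^{n×n} with ‖P‖_∞ ≤ 3δ satisfying the quadratic matrix equation P + Pᵀ + P·Σ^{−1}·Pᵀ = R. -/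
open Matrix

/-- The weighted row product `A * diagonal d * Bᵀ`, entrywise. -/
def weightedMul {n : ℕ} (d : Fin n → ℝ) (A B : Fin n → Fin n → ℝ) (i j : Fin n) : ℝ :=
  ∑ k, A i k * d k * B j k

lemma abs_weightedMul_le {n : ℕ} {d : Fin n → ℝ} (hd : ∀ i, 0 ≤ d i)
    {A B : Fin n → Fin n → ℝ} {a b : ℝ} (hA : ∀ i j, |A i j| ≤ a) (hB : ∀ i j, |B i j| ≤ b)
    (i j : Fin n) : |weightedMul d A B i j| ≤ (∑ k, d k) * (a * b) := by
  unfold weightedMul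
  rw [Finset.sum_mul]
  refine (Finset.abs_sum_le_sum_abs _ _).trans (Finset.sum_le_sum fun k _ => ?_)
  rw [abs_mul, abs_mul, abs_of_nonneg (hd k)]
  have ha : 0 ≤ a := (abs_nonneg _).trans (hA i k)
  calc |A i k| * d k * |B j k| = d k * (|A i k| * |B j k|) := by ring
    _ ≤ d k * (a * b) := mul_le_mul_of_nonneg_left
      (mul_le_mul (hA i k) (hB j k) (abs_nonneg _) ha) (hd k)

lemma weightedMul_self_sub {n : ℕ} (d : Fin n → ℝ) (A B : Fin n → Fin n → ℝ) (i j : Fin n) :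
    weightedMul d A A i j - weightedMul d B B i j =
      weightedMul d (A - B) A i j + weightedMul d B (A - B) i j := by
  simp only [weightedMul, ← Finset.sum_sub_distrib, ← Finset.sum_add_distrib, Pi.sub_apply]
  exact Finset.sum_congr rfl fun k _ => by ring

lemma weightedMul_self_comm {n : ℕ} (d : Fin n → ℝ) (A : Fin n → Fin n → ℝ) (i j : Fin n) :
    weightedMul d A A i j = weightedMul d A A j i :=
  Finset.sum_congr rfl fun k _ => by ring

/-- The weights splitting a symmetric matrix into an upper-triangular matrix plus its transpose. -/
noncomputable def upperWeight {n : ℕ} (i j : Fin n) : ℝ :=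
  if j < i then 0 else if i = j then 1 / 2 else 1

lemma abs_upperWeight_mul_le {n : ℕ} (i j : Fin n) (x : ℝ) : |upperWeight i j * x| ≤ |x| := by
  rw [abs_mul]
  refine mul_le_of_le_one_left (abs_nonneg x) ?_
  unfold upperWeight
  split_ifs <;> norm_num [abs_of_pos]

lemma upperWeight_add_swap {n : ℕ} (i j : Fin n) : upperWeight i j + upperWeight j i = 1 := by
  unfold upperWeight
  rcases lt_trichotomy i j with h | h | h
  · simp [h, h.not_gt, h.ne]
  · subst h; norm_num
  · simp [h, h.not_gt, h.ne]

/-- The map whose fixed points are the upper-triangular solutions of the quadratic equation. -/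
noncomputable def upperStep {n : ℕ} (d : Fin n → ℝ) (R P : Fin n → Fin n → ℝ) :
    Fin n → Fin n → ℝ :=
  fun i j => upperWeight i j * (R i j - weightedMul d P P i j)

lemma exists_upperStep_fixed {n : ℕ} {d : Fin n → ℝ} (hd : ∀ i, 0 ≤ d i) {δ : ℝ} (hδ : 0 < δ)
    (hsmall : 12 * (∑ k, d k) * δ ≤ 1) {R : Fin n → Fin n → ℝ} (hR : ∀ i j, |R i j| ≤ δ) :
    ∃ P : Fin n → Fin n → ℝ, (∀ i j, |P i j| ≤ 3 * δ) ∧ upperStep d R P = P := by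
  have hC : 0 ≤ ∑ k, d k := Finset.sum_nonneg fun k _ => hd k
  set C := ∑ k, d k
  let s : Set (Fin n → Fin n → ℝ) := {P | ∀ i j, |P i j| ≤ 3 * δ}
  have hs : IsClosed s := by
    simp only [s, Set.ofPred_forall]
    exact isClosed_iInter fun i => isClosed_iInter fun j =>
      isClosed_le (by fun_prop) continuous_const
  have hmaps : Set.MapsTo (upperStep d R) s s := fun P hP i j => by
    have h := abs_weightedMul_le hd hP hP i j
    calc |upperStep d R P i j| ≤ |R i j - weightedMul d P P i j| := abs_upperWeight_mul_le i j _
      _ ≤ |R i j| + |weightedMul d P P i j| := abs_sub _ _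
      _ ≤ 3 * δ := by nlinarith [hR i j]
  have hcontr : ContractingWith (1 / 2) (hmaps.restrict (upperStep d R) s s) := by
    refine ⟨by rw [← NNReal.coe_lt_coe]; norm_num, LipschitzWith.of_dist_le_mul ?_⟩
    rintro ⟨P, hP⟩ ⟨Q, hQ⟩
    change dist (upperStep d R P) (upperStep d R Q) ≤ ((1 / 2 : NNReal) : ℝ) * dist P Q
    have hr : ((1 / 2 : NNReal) : ℝ) = 1 / 2 := by norm_num
    rw [hr]
    have hD : 0 ≤ dist P Q := dist_nonneg
    have hPQ : ∀ i j, |(P - Q) i j| ≤ dist P Q := fun i j =>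
      (dist_le_pi_dist (P i) (Q i) j).trans (dist_le_pi_dist P Q i)
    refine (dist_pi_le_iff (by positivity)).2 fun i => (dist_pi_le_iff (by positivity)).2
      fun j => ?_
    have h₁ := abs_weightedMul_le hd hPQ hP i j
    have h₂ := abs_weightedMul_le hd hQ hPQ i j
    have hsub : upperStep d R P i j - upperStep d R Q i j =
        upperWeight i j * -(weightedMul d P P i j - weightedMul d Q Q i j) := by
      unfold upperStep; ring
    rw [Real.dist_eq, hsub]
    refine (abs_upperWeight_mul_le i j _).trans ?_
    rw [abs_neg, weightedMul_self_sub]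
    refine (abs_add_le _ _).trans ?_
    nlinarith [mul_le_mul_of_nonneg_right hsmall hD]
  obtain ⟨P, hP, hfix, -⟩ := hcontr.exists_fixedPoint' hs.isComplete hmaps
    (x := 0) (fun i j => by simpa using hδ.le) (edist_ne_top _ _)
  exact ⟨P, hP, hfix⟩

/-- For a diagonal positive definite `S ∈ ℝ^{n×n}` there is `δ₀ > 0` such that
for every `0 < δ < δ₀` and every symmetric `R` with `‖R‖_∞ ≤ δ` there is an upper-triangular `P`
with `‖P‖_∞ ≤ 3δ` solving `P + Pᵀ + P·S⁻¹·Pᵀ = R`. -/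
theorem statement_19 {n : ℕ} (S : Matrix (Fin n) (Fin n) ℝ)
    (hdiag : ∀ i j : Fin n, i ≠ j → S i j = 0)
    (hpos : ∀ i : Fin n, 0 < S i i) :
    ∃ δ₀ > 0, ∀ δ : ℝ, 0 < δ → δ < δ₀ →
      ∀ R : Matrix (Fin n) (Fin n) ℝ, Rᵀ = R → (∀ i j, |R i j| ≤ δ) →
        ∃ P : Matrix (Fin n) (Fin n) ℝ,
          (∀ i j : Fin n, (j : ℕ) < (i : ℕ) → P i j = 0) ∧
          (∀ i j, |P i j| ≤ 3 * δ) ∧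
          P + Pᵀ + P * S⁻¹ * Pᵀ = R := by
  have hS : S⁻¹ = diagonal fun i => (S i i)⁻¹ := by
    refine inv_eq_right_inv ?_
    have hSd : S = diagonal fun i => S i i := by
      ext i j
      rcases eq_or_ne i j with rfl | h
      · simp
      · rw [diagonal_apply_ne _ h, hdiag i j h]
    nth_rewrite 1 [hSd]
    rw [diagonal_mul_diagonal, ← diagonal_one]
    exact congrArg diagonal (funext fun i => mul_inv_cancel₀ (hpos i).ne')
  have hd : ∀ i, 0 ≤ (S i i)⁻¹ := fun i => (inv_pos.2 (hpos i)).le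
  have hC : 0 ≤ ∑ i, (S i i)⁻¹ := Finset.sum_nonneg fun i _ => hd i
  refine ⟨1 / (12 * (∑ i, (S i i)⁻¹ + 1)), by positivity, fun δ hδ hlt R hsymm hR => ?_⟩
  rw [lt_div_iff₀ (by positivity)] at hlt
  obtain ⟨P, hP, hfix⟩ := exists_upperStep_fixed (d := fun i => (S i i)⁻¹) hd hδ
    (by nlinarith) hR
  have hentry : ∀ i j, P i j =
      upperWeight i j * (R i j - weightedMul (fun i => (S i i)⁻¹) P P i j) :=
    fun i j => (congrFun (congrFun hfix i) j).symm
  refine ⟨of P, fun i j hij => ?_, hP, ?_⟩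
  · have hij' : j < i := hij
    rw [of_apply, hentry, upperWeight, if_pos hij', zero_mul]
  · ext i j
    have hmul : (of P * S⁻¹ * (of P)ᵀ) i j = weightedMul (fun i => (S i i)⁻¹) P P i j := by
      rw [hS, mul_apply]
      simp [weightedMul, mul_diagonal]
    have hRij : R j i = R i j := congrFun (congrFun hsymm i) j
    have hji := hentry j i
    rw [hRij, weightedMul_self_comm] at hji
    rw [Matrix.add_apply, Matrix.add_apply, hmul, transpose_apply, of_apply, of_apply, hji,
      hentry i j, ← add_mul, upperWeight_add_swap]
    ring
end
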